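/- arXiv:2505.09275 — 5 statements merged into one kernel-verified Lean document; each statement's English description precedes it below -/
import Mathlib

section
/- For every positive integer n and every i with 1 ≤ i ≤ n, the identity (-1)^n ∑_{j=1}^{n} ((x_j - x_i)(1 + (1+w) x_i x_j))/((x_i + x_j + w x_i x_j)(1 - x_i x_j)) · ((1+x_j)/x_j) ∏_{p≠j} (1 - x_j x_p)/(x_j - x_p) + ((1-x_i)/x_i) ∏_{p≠i} (1 + w x_i + x_i x_p)/(x_i + x_p + w x_i x_p) = (-1)^n + ∏_{k=1}^{n} 1/x_k holds as an identity of rational functions in x_1,...,x_n and w. -/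
open Polynomial in
/-- Lagrange interpolation of the difference of two monic polynomials of equal degree. -/
theorem aux_lagrange {K ι : Type*} [Field K] [DecidableEq ι] (s : Finset ι) (v y : ι → K) (t : K)
    (hv : Set.InjOn v s) (ht : ∀ p ∈ s, t ≠ v p) :
    ∏ p ∈ s, (t - y p) - ∏ p ∈ s, (t - v p) = (∏ p ∈ s, (t - v p)) *
      ∑ j ∈ s, (∏ p ∈ s.erase j, (v j - v p)⁻¹) * (t - v j)⁻¹ * ∏ p ∈ s, (v j - y p) := by
  have hdeg : (Lagrange.nodal s y - Lagrange.nodal s v).degree < (s.card : WithBot ℕ) := by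
    have := Polynomial.degree_sub_lt_left (p := Lagrange.nodal s y) (q := Lagrange.nodal s v)
      (by rw [Lagrange.degree_nodal, Lagrange.degree_nodal]) Lagrange.nodal_ne_zero
      (by rw [Lagrange.nodal_monic.leadingCoeff, Lagrange.nodal_monic.leadingCoeff])
    rwa [Lagrange.degree_nodal] at this
  have h := Lagrange.eq_interpolate_of_eval_eq (fun j => ∏ p ∈ s, (v j - y p)) hv hdeg
    (by
      intro j hj
      rw [eval_sub, Lagrange.eval_nodal_at_node hj, Lagrange.eval_nodal, sub_zero])
  have h' := congrArg (Polynomial.eval t) h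
  rw [Lagrange.eval_interpolate_not_at_node _ ht, eval_sub, Lagrange.eval_nodal,
    Lagrange.eval_nodal] at h'
  exact h'

theorem aux_B {K ι : Type*} [Field K] [DecidableEq ι] (s : Finset ι) (x : ι → K) (a b : K)
    (ha : a ≠ 0) (hx : ∀ p ∈ s, x p ≠ 0) (hinj : Set.InjOn x s)
    (hd : ∀ p ∈ s, a + b * x p ≠ 0) :
    ∑ j ∈ s, (1 - x j ^ 2) / (x j * (a + b * x j)) *
        ∏ p ∈ s.erase j, (1 - x j * x p) / (x j - x p)
      = a⁻¹ * (∏ p ∈ s, (-((b + a * x p) / (a + b * x p))) - ∏ p ∈ s, (-(x p)⁻¹)) := by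
  have hfac : ∀ p ∈ s, -b / a - (x p)⁻¹ = -(a + b * x p) / (a * x p) := by
    intro p hp
    have := hx p hp
    field_simp
    ring
  have hne : ∀ p ∈ s, -b / a - (x p)⁻¹ ≠ 0 := by
    intro p hp
    rw [hfac p hp]
    exact div_ne_zero (neg_ne_zero.mpr (hd p hp)) (mul_ne_zero ha (hx p hp))
  have key := aux_lagrange s (fun p => (x p)⁻¹) x (-b / a)
    (fun p hp q hq h => hinj hp hq (inv_injective h))
    (fun p hp => sub_ne_zero.mp (hne p hp))
  have hP : ∏ p ∈ s, (-b / a - (x p)⁻¹) ≠ 0 := Finset.prod_ne_zero_iff.mpr hne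
  have hsum : ∑ j ∈ s, (1 - x j ^ 2) / (x j * (a + b * x j)) *
        ∏ p ∈ s.erase j, (1 - x j * x p) / (x j - x p)
      = a⁻¹ * (∏ p ∈ s, (-(x p)⁻¹)) * ∑ j ∈ s, (∏ p ∈ s.erase j, ((x j)⁻¹ - (x p)⁻¹)⁻¹) *
          (-b / a - (x j)⁻¹)⁻¹ * ∏ p ∈ s, ((x j)⁻¹ - x p) := by
    rw [Finset.mul_sum]
    refine Finset.sum_congr rfl fun j hj => ?_
    have hxj := hx j hj
    have hdj := hd j hj
    rw [← Finset.mul_prod_erase s (fun p => (-(x p)⁻¹)) hj,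
      ← Finset.mul_prod_erase s (fun p => ((x j)⁻¹ - x p)) hj]
    have e1 : ∏ p ∈ s.erase j, (1 - x j * x p) / (x j - x p)
        = (∏ p ∈ s.erase j, (-(x p)⁻¹)) * (∏ p ∈ s.erase j, ((x j)⁻¹ - (x p)⁻¹)⁻¹) *
          ∏ p ∈ s.erase j, ((x j)⁻¹ - x p) := by
      rw [← Finset.prod_mul_distrib, ← Finset.prod_mul_distrib]
      refine Finset.prod_congr rfl fun p hp => ?_
      obtain ⟨hpj, hps⟩ := Finset.mem_erase.mp hp
      have hxp := hx p hps
      have h1 : x j - x p ≠ 0 := sub_ne_zero.mpr fun h => hpj (hinj hps hj h.symm)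
      have h3 : (x j)⁻¹ - (x p)⁻¹ = -(x j - x p) / (x j * x p) := by
        field_simp
        ring
      rw [h3]
      field_simp
    have e2 : (1 - x j ^ 2) / (x j * (a + b * x j))
        = a⁻¹ * (-(x j)⁻¹) * (-b / a - (x j)⁻¹)⁻¹ * ((x j)⁻¹ - x j) := by
      rw [hfac j hj]
      field_simp
    rw [e1, e2]
    ring
  rw [hsum]
  have h4 : ∏ p ∈ s, (-((b + a * x p) / (a + b * x p)))
      = (∏ p ∈ s, (-(x p)⁻¹)) * ((∏ p ∈ s, (-b / a - x p)) / ∏ p ∈ s, (-b / a - (x p)⁻¹)) := by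
    rw [← Finset.prod_div_distrib, ← Finset.prod_mul_distrib]
    refine Finset.prod_congr rfl fun p hp => ?_
    have hxp := hx p hp
    have hdp := hd p hp
    rw [hfac p hp]
    field_simp
    ring
  have h5 := eq_div_of_mul_eq hP ((mul_comm _ _).trans key.symm)
  rw [h4, h5, sub_div, div_self hP]
  ring

theorem aux_A' {K ι : Type*} [Field K] [DecidableEq ι] (s : Finset ι) (x : ι → K)
    (hx : ∀ p ∈ s, x p ≠ 0) (hinj : Set.InjOn x s) (hd : ∀ p ∈ s, x p ≠ 1) :
    ∑ j ∈ s, (1 + x j) / x j * ∏ p ∈ s.erase j, (1 - x j * x p) / (x j - x p)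
      = 1 - ∏ p ∈ s, (-(x p)⁻¹) := by
  have hd' : ∀ p ∈ s, 1 + (-1) * x p ≠ 0 := by
    intro p hp h
    exact hd p hp (by linear_combination -h)
  have h := aux_B s x 1 (-1) one_ne_zero hx hinj hd'
  have e : ∏ p ∈ s, (-((-1 + 1 * x p) / (1 + (-1) * x p))) = 1 := by
    refine Finset.prod_eq_one fun p hp => ?_
    have := hd' p hp
    rw [← neg_div, div_eq_one_iff_eq this]
    ring
  rw [e, inv_one, one_mul] at h
  rw [← h]
  refine Finset.sum_congr rfl fun j hj => ?_
  congr 1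
  have h1 := hd' j hj
  have h2 := hx j hj
  rw [div_eq_div_iff h2 (mul_ne_zero h2 h1)]
  ring

theorem aux_A {K ι : Type*} [Field K] [DecidableEq ι] (s : Finset ι) (x : ι → K)
    (hx : ∀ p ∈ s, x p ≠ 0) (hinj : Set.InjOn x s) :
    ∑ j ∈ s, (1 + x j) / x j * ∏ p ∈ s.erase j, (1 - x j * x p) / (x j - x p)
      = 1 - ∏ p ∈ s, (-(x p)⁻¹) := by
  by_cases hq : ∃ q ∈ s, x q = 1
  · obtain ⟨q, hqs, hq1⟩ := hq
    have hne : ∀ p ∈ s.erase q, x p ≠ 1 := by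
      intro p hp h
      obtain ⟨hpq, hps⟩ := Finset.mem_erase.mp hp
      exact hpq (hinj hps hqs (h.trans hq1.symm))
    have h := aux_A' (s.erase q) x (fun p hp => hx p (Finset.mem_of_mem_erase hp))
      (hinj.mono (by simp)) hne
    rw [← Finset.add_sum_erase s _ hqs, ← Finset.mul_prod_erase s (fun p => (-(x p)⁻¹)) hqs]
    have e1 : ∏ p ∈ s.erase q, (1 - x q * x p) / (x q - x p) = 1 := by
      refine Finset.prod_eq_one fun p hp => ?_
      rw [hq1, one_mul, div_self]
      exact sub_ne_zero.mpr (hne p hp).symm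
    have e2 : ∑ j ∈ s.erase q, (1 + x j) / x j *
          ∏ p ∈ s.erase j, (1 - x j * x p) / (x j - x p)
        = - ∑ j ∈ s.erase q, (1 + x j) / x j *
          ∏ p ∈ (s.erase q).erase j, (1 - x j * x p) / (x j - x p) := by
      rw [← Finset.sum_neg_distrib]
      refine Finset.sum_congr rfl fun j hj => ?_
      have hqj : q ∈ s.erase j := Finset.mem_erase.mpr ⟨(Finset.ne_of_mem_erase hj).symm, hqs⟩
      rw [← Finset.mul_prod_erase (s.erase j) _ hqj, Finset.erase_right_comm]
      have h1 : x j - 1 ≠ 0 := sub_ne_zero.mpr (hne j hj)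
      have h2 : (1 - x j * x q) / (x j - x q) = -1 := by
        rw [hq1, div_eq_iff h1]
        ring
      rw [h2]
      ring
    rw [e1, e2, h, hq1]
    norm_num
    ring
  · push Not at hq
    exact aux_A' s x hx hinj hq

/-- Lemma 4.1(ii): an identity of rational functions in `x_1,…,x_n` and `w`,
stated in an arbitrary field with all relevant denominators assumed nonzero. -/
theorem stmt2 {K : Type*} [Field K] (n : ℕ) (hn : 0 < n) (x : Fin n → K) (w : K)
    (i : Fin n) (hx : ∀ j, x j ≠ 0) (hinj : Function.Injective x)
    (h1 : ∀ j, x i + x j + w * x i * x j ≠ 0)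
    (h2 : ∀ j, 1 - x i * x j ≠ 0) :
    (-1 : K) ^ n * (∑ j : Fin n,
        ((x j - x i) * (1 + (1 + w) * x i * x j)) /
            ((x i + x j + w * x i * x j) * (1 - x i * x j)) *
          (((1 + x j) / x j) *
            ∏ p ∈ Finset.univ.erase j, (1 - x j * x p) / (x j - x p)))
      + ((1 - x i) / x i) *
          ∏ p ∈ Finset.univ.erase i,
            (1 + w * x i + x i * x p) / (x i + x p + w * x i * x p)
    = (-1 : K) ^ n + ∏ k : Fin n, (x k)⁻¹ := by
  set a := x i with ha_def
  have ha : a ≠ 0 := hx i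
  set s : Finset (Fin n) := Finset.univ.erase i with hs
  have hA := aux_A s x (fun p _ => hx p) hinj.injOn
  have hB := aux_B s x a (1 + w * a) ha (fun p _ => hx p) hinj.injOn
    (fun p _ h => h1 p (by linear_combination h))
  have hsum : ∑ j : Fin n, ((x j - a) * (1 + (1 + w) * a * x j)) /
            ((a + x j + w * a * x j) * (1 - a * x j)) *
          (((1 + x j) / x j) *
            ∏ p ∈ Finset.univ.erase j, (1 - x j * x p) / (x j - x p))
      = ∑ j ∈ s, (1 + x j) / x j * ∏ p ∈ s.erase j, (1 - x j * x p) / (x j - x p)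
        + (1 - a) * ∑ j ∈ s, (1 - x j ^ 2) / (x j * (a + (1 + w * a) * x j)) *
        ∏ p ∈ s.erase j, (1 - x j * x p) / (x j - x p) := by
    rw [← Finset.add_sum_erase Finset.univ _ (Finset.mem_univ i), ← ha_def, sub_self, zero_mul,
      zero_div, zero_mul, zero_add, Finset.mul_sum, ← Finset.sum_add_distrib]
    refine Finset.sum_congr rfl fun j hj => ?_
    have hji : j ≠ i := Finset.ne_of_mem_erase hj
    have hij : i ∈ Finset.univ.erase j := Finset.mem_erase.mpr ⟨hji.symm, Finset.mem_univ i⟩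
    rw [← Finset.mul_prod_erase (Finset.univ.erase j) _ hij, Finset.erase_right_comm, ← hs,
      ← ha_def]
    generalize ∏ p ∈ s.erase j, (1 - x j * x p) / (x j - x p) = Q
    have d1 : x j - a ≠ 0 := sub_ne_zero.mpr fun h => hji (hinj h)
    have d2 := hx j
    have d3 := h1 j
    have d4 := h2 j
    have d5 : a + (1 + w * a) * x j = a + x j + w * a * x j := by ring
    have d6 : 1 - x j * a = 1 - a * x j := by ring
    rw [d5, d6]
    generalize hD : a + x j + w * a * x j = D at *
    generalize hE : 1 - a * x j = E at *
    field_simp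
    rw [← hD]
    ring
  rw [hsum, hA, hB]
  have hcard : s.card + 1 = n := by
    rw [hs, Finset.card_erase_of_mem (Finset.mem_univ i), Finset.card_univ, Fintype.card_fin]
    omega
  have hpow : (-1 : K) ^ n = (-1 : K) ^ s.card * (-1) := by
    rw [← pow_succ, hcard]
  have hprod : ∏ p ∈ s, (1 + w * a + a * x p) / (a + x p + w * a * x p)
      = ∏ p ∈ s, (1 + w * a + a * x p) / (a + (1 + w * a) * x p) := by
    refine Finset.prod_congr rfl fun p _ => ?_
    congr 1
    ring
  rw [hprod, ← Finset.mul_prod_erase Finset.univ (fun k => (x k)⁻¹) (Finset.mem_univ i), ← hs,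
    ← ha_def, Finset.prod_neg, Finset.prod_neg, hpow]
  have hsq : (-1 : K) ^ s.card * (-1 : K) ^ s.card = 1 := by
    rw [← mul_pow]
    simp
  clear hpow
  generalize (-1 : K) ^ s.card = e at *
  generalize ∏ p ∈ s, (1 + w * a + a * x p) / (a + (1 + w * a) * x p) = R
  generalize ∏ p ∈ s, (x p)⁻¹ = P
  have hai : a * a⁻¹ = 1 := mul_inv_cancel₀ ha
  rw [div_eq_mul_inv]
  generalize a⁻¹ = c at *
  linear_combination (P - (1 - a) * c * (R - P)) * hsq - P * hai
end

section
/- (Schur's Pfaffian identity, Cayley–Möbius form) For every positive integer n, pf_{χ_even(n) ≤ i < j ≤ n}(a_{ij}) = ∏_{1 ≤ i < j ≤ n} (x_j - x_i)/(1 - x_i x_j), where a_{0j} = 1 and a_{ij} = (x_j - x_i)/(1 - x_i x_j) for i ≥ 1, and χ_even(n) = 1 if n is even, 0 if n is odd. -/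
noncomputable section

/-- The field of rational functions `ℚ(x_0, x_1, x_2, …)`. -/
abbrev KK : Type := FractionRing (MvPolynomial ℕ ℚ)

/-- The indeterminates `x_i`. -/
def xx (i : ℕ) : KK := algebraMap (MvPolynomial ℕ ℚ) KK (MvPolynomial.X i)

/-- The Pfaffian of a `2m × 2m` matrix (intended to be skew-symmetric), via the
permutation-sum formula. -/
def pfaffian {K : Type*} [Field K] {m : ℕ}
    (A : Matrix (Fin (2 * m)) (Fin (2 * m)) K) : K :=
  (∑ σ : Equiv.Perm (Fin (2 * m)), ((Equiv.Perm.sign σ : ℤ) : K) *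
      ∏ i : Fin m, A (σ ⟨2 * i.val, by omega⟩) (σ ⟨2 * i.val + 1, by omega⟩)) /
    ((2 ^ m * Nat.factorial m : ℕ) : K)

/-- The label of the `p`-th row/column of the triangular array indexed by
`χ_even(n) ≤ i < j ≤ n`: the labels are `1,…,n` for even `n` and `0,…,n` for odd `n`. -/
def lab (n p : ℕ) : ℕ := if Even n then p + 1 else p

/-- The skew-symmetric completion of the triangular array `(a i j)_{χ_even(n) ≤ i < j ≤ n}`;
its size `2⌈n/2⌉` is even in both cases. -/
def pfArray (n : ℕ) (a : ℕ → ℕ → KK) :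
    Matrix (Fin (2 * ((n + 1) / 2))) (Fin (2 * ((n + 1) / 2))) KK :=
  fun i j =>
    if lab n i < lab n j then a (lab n i) (lab n j)
    else if lab n j < lab n i then -(a (lab n j) (lab n i)) else 0

section SchurHelpers

variable {K : Type*} [Field K]

/-- The Schur kernel `(v - u) / (v + u)`. -/
def schurT (u v : K) : K := (v - u) / (v + u)

lemma schur_sum_aux [DecidableEq K] (s : Finset K) (h0 : (0 : K) ∉ s) :
    2 * ∑ b ∈ s, ∏ k ∈ s.erase b, (b + k) / (b - k) = 1 - (-1) ^ s.card := by
  have hmon : (∏ k ∈ s, (Polynomial.X + Polynomial.C k)).Monic :=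
    Polynomial.monic_prod_of_monic _ _ (fun k _ => Polynomial.monic_X_add_C k)
  have hdeg : (∏ k ∈ s, (Polynomial.X + Polynomial.C k)).degree = (s.card : WithBot ℕ) := by
    rw [Polynomial.degree_prod]
    simp
  have key := Lagrange.leadingCoeff_eq_sum (s := insert 0 s) (v := (id : K → K))
    (P := ∏ k ∈ s, (Polynomial.X + Polynomial.C k)) (fun _ _ _ _ h => h)
    (by rw [hdeg, Finset.card_insert_of_notMem h0]; push_cast; rfl)
  rw [hmon.leadingCoeff, Finset.sum_insert h0, Finset.erase_insert h0] at key
  have e0 : Polynomial.eval (id (0 : K)) (∏ k ∈ s, (Polynomial.X + Polynomial.C k)) /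
      ∏ j ∈ s, (id (0 : K) - id j) = (-1) ^ s.card := by
    rw [Polynomial.eval_prod, ← Finset.prod_div_distrib, ← Finset.prod_const]
    refine Finset.prod_congr rfl fun k hk => ?_
    have : k ≠ 0 := fun h => h0 (h ▸ hk)
    simp
    field_simp
  rw [e0] at key
  have key := sub_eq_of_eq_add' key
  rw [key, Finset.mul_sum]
  refine Finset.sum_congr rfl fun b hb => ?_
  have hb0 : b ≠ 0 := fun h => h0 (h ▸ hb)
  rw [Finset.erase_insert_of_ne hb0.symm, Finset.prod_insert (by simp [h0]),
    Polynomial.eval_prod, ← Finset.mul_prod_erase s _ hb, Finset.prod_div_distrib]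
  simp only [id, Polynomial.eval_add, Polynomial.eval_X, Polynomial.eval_C, sub_zero]
  rw [mul_div_mul_comm, ← two_mul, mul_div_cancel_right₀ _ hb0]

lemma schur_sum_even [DecidableEq K] (h2 : (2 : K) ≠ 0) (s : Finset K) (hs : Even s.card) :
    ∑ b ∈ s, ∏ k ∈ s.erase b, (b + k) / (b - k) = 0 := by
  by_cases h0 : (0 : K) ∈ s
  · obtain ⟨t, ht, rfl⟩ : ∃ t, (0 : K) ∉ t ∧ s = insert 0 t :=
      ⟨s.erase 0, by simp, (Finset.insert_erase h0).symm⟩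
    have hodd : Odd t.card := by
      rw [Finset.card_insert_of_notMem ht] at hs
      rwa [Nat.even_add_one, Nat.not_even_iff_odd] at hs
    have h := schur_sum_aux t ht
    rw [hodd.neg_one_pow] at h
    have h' : ∑ b ∈ t, ∏ k ∈ t.erase b, (b + k) / (b - k) = 1 := by
      apply mul_left_cancel₀ h2
      rw [h]; norm_num
    rw [Finset.sum_insert ht, Finset.erase_insert ht]
    have e0 : ∏ k ∈ t, ((0 : K) + k) / (0 - k) = -1 := by
      rw [← hodd.neg_one_pow, ← Finset.prod_const]
      refine Finset.prod_congr rfl fun k hk => ?_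
      have : k ≠ 0 := fun h => ht (h ▸ hk)
      simp
      field_simp
    have e1 : ∑ b ∈ t, ∏ k ∈ (insert 0 t).erase b, (b + k) / (b - k) = 1 := by
      rw [← h']
      refine Finset.sum_congr rfl fun b hb => ?_
      have hb0 : b ≠ 0 := fun h => ht (h ▸ hb)
      rw [Finset.erase_insert_of_ne hb0.symm, Finset.prod_insert (by simp [ht])]
      simp [hb0]
    rw [e0, e1]; norm_num
  · have h := schur_sum_aux s h0
    rw [hs.neg_one_pow, sub_self] at h
    exact (mul_eq_zero.mp h).resolve_left h2

lemma schur_main (h2 : (2 : K) ≠ 0) (m : ℕ) (a : K) (z : Fin (2 * m + 1) → K)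
    (hz : Function.Injective z) (ha : ∀ i, z i + a ≠ 0) :
    ∑ q, schurT a (z q) * ∏ k ∈ Finset.univ.erase q, (schurT (z q) (z k))⁻¹
      = ∏ k, schurT a (z k) := by
  classical
  have hna : -a ∉ Finset.univ.image z := by
    simp only [Finset.mem_image, Finset.mem_univ, true_and, not_exists]
    intro i hi
    exact ha i (by rw [hi]; ring)
  have hcard : (Finset.univ.image z).card = 2 * m + 1 := by
    rw [Finset.card_image_of_injective _ hz]; simp
  have h := schur_sum_even h2 (insert (-a) (Finset.univ.image z))
    (by rw [Finset.card_insert_of_notMem hna, hcard]; exact ⟨m + 1, by ring⟩)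
  rw [Finset.sum_insert hna, Finset.erase_insert hna, Finset.prod_image (fun _ _ _ _ h => hz h),
    Finset.sum_image (fun _ _ _ _ h => hz h)] at h
  have e1 : ∏ k, (-a + z k) / (-a - z k) = - ∏ k, schurT a (z k) := by
    have : ∀ k, (-a + z k) / (-a - z k) = (-1) * schurT a (z k) := by
      intro k
      have := ha k
      have h3 : -a - z k ≠ 0 := by
        intro h; apply this; linear_combination -h
      unfold schurT
      field_simp
      ring
    simp_rw [this, Finset.prod_mul_distrib]
    simp [pow_succ]
  have e2 : ∀ q, ∏ k ∈ (insert (-a) (Finset.univ.image z)).erase (z q), (z q + k) / (z q - k)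
      = schurT a (z q) * ∏ k ∈ Finset.univ.erase q, (schurT (z q) (z k))⁻¹ := by
    intro q
    have hne : -a ≠ z q := fun h => hna (by simp [h])
    rw [Finset.erase_insert_of_ne hne, Finset.prod_insert (by
      intro h; exact hna (Finset.mem_of_mem_erase h)), ← Finset.image_erase hz,
      Finset.prod_image (fun _ _ _ _ h => hz h)]
    congr 1
    · unfold schurT; ring
    · have : ∀ k, (z q + z k) / (z q - z k) = (-1) * (schurT (z q) (z k))⁻¹ := by
        intro k
        unfold schurT
        rw [inv_div, ← neg_sub (z k) (z q), div_neg, add_comm]; ring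
      simp_rw [this, Finset.prod_mul_distrib]
      simp
  rw [e1, Finset.sum_congr rfl (fun q _ => e2 q)] at h
  linear_combination h

lemma prod_swap_succ {n : ℕ} (q : Fin (n + 1)) (f : Fin (n + 1) → K) :
    ∏ k : Fin n, f (Equiv.swap 0 q k.succ) = ∏ k ∈ Finset.univ.erase q, f k := by
  have h : Finset.univ.erase q = (Finset.univ : Finset (Fin n)).image
      (fun k => Equiv.swap 0 q k.succ) := by
    ext j
    simp only [Finset.mem_erase, Finset.mem_univ, and_true, Finset.mem_image, true_and]
    constructor
    · intro hj
      have : Equiv.swap 0 q j ≠ 0 := by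
        intro h
        apply hj
        have := congrArg (Equiv.swap 0 q) h
        simpa using this
      obtain ⟨k, hk⟩ := Fin.exists_succ_eq.mpr this
      exact ⟨k, by rw [hk]; simp⟩
    · rintro ⟨k, rfl⟩ h
      have := congrArg (Equiv.swap 0 q) h
      simp at this
  rw [h, Finset.prod_image]
  intro a _ b _ hab
  simpa using hab

/-- Admissible parameter families. -/
def SchurGood {n : ℕ} (y : Fin n → K) : Prop :=
  ∀ i j, i ≠ j → y i ≠ y j ∧ y i + y j ≠ 0

/-- The product side. -/
def schurP {n : ℕ} (y : Fin n → K) : K := ∏ i, ∏ j ∈ Finset.Ioi i, schurT (y i) (y j)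

/-- The pairing product divided by the product side. -/
def schurH {m : ℕ} (y : Fin (2 * m) → K) : K :=
  (∏ i : Fin m, schurT (y ⟨2 * i.val, by omega⟩) (y ⟨2 * i.val + 1, by omega⟩)) / schurP y

lemma schurT_ne {n : ℕ} {y : Fin n → K} (hy : SchurGood y) {i j : Fin n} (h : i ≠ j) :
    schurT (y i) (y j) ≠ 0 :=
  div_ne_zero (sub_ne_zero.mpr (hy j i h.symm).1) (hy j i h.symm).2

lemma schurP_succ {n : ℕ} (y : Fin (n + 1) → K) :
    schurP y = (∏ k : Fin n, schurT (y 0) (y k.succ)) * schurP (fun k => y k.succ) := by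
  unfold schurP
  rw [Fin.prod_univ_succ]
  simp only [Fin.prod_Ioi_zero, Fin.prod_Ioi_succ]

lemma schurH_succ {m : ℕ} (y : Fin (2 * (m + 1)) → K) (hy : SchurGood y) :
    schurH y = schurH (m := m) (fun k : Fin (2 * m) => y k.succ.succ) *
      ∏ k : Fin (2 * m), ((schurT (y 0) (y k.succ.succ))⁻¹ *
        (schurT (y (Fin.succ 0)) (y k.succ.succ))⁻¹) := by
  have hT := schurT_ne hy (show (0 : Fin (2 * m + 2)) ≠ Fin.succ 0 by simp)
  have hP : schurP y = schurT (y 0) (y (Fin.succ 0)) *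
      (∏ k : Fin (2 * m), schurT (y 0) (y k.succ.succ)) *
      ((∏ k : Fin (2 * m), schurT (y (Fin.succ 0)) (y k.succ.succ)) *
      schurP (fun k : Fin (2 * m) => y k.succ.succ)) := by
    have h1 := schurP_succ (n := 2 * m + 1) y
    rw [Fin.prod_univ_succ, schurP_succ (n := 2 * m) (fun k => y k.succ)] at h1
    exact h1
  unfold schurH
  rw [hP, Fin.prod_univ_succ, Finset.prod_mul_distrib, Finset.prod_inv_distrib,
    Finset.prod_inv_distrib]
  have e1 : schurT (y ⟨2 * (0 : Fin (m + 1)).val, by simp⟩)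
      (y ⟨2 * (0 : Fin (m + 1)).val + 1, by simp; omega⟩) = schurT (y 0) (y (Fin.succ 0)) := rfl
  have e2 : ∀ i : Fin m, schurT (y ⟨2 * i.succ.val, by have := i.2; simp only [Fin.val_succ]; omega⟩)
      (y ⟨2 * i.succ.val + 1, by have := i.2; simp only [Fin.val_succ]; omega⟩) =
      schurT (y (Fin.succ (Fin.succ (⟨2 * i.val, by omega⟩ : Fin (2 * m)))))
        (y (Fin.succ (Fin.succ (⟨2 * i.val + 1, by omega⟩ : Fin (2 * m))))) := fun i => rfl
  rw [e1, Finset.prod_congr rfl (fun i _ => e2 i)]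
  rw [mul_assoc, mul_div_mul_left _ _ hT]
  simp only [div_eq_mul_inv, mul_inv]
  ring

lemma sum_perm_succ {n : ℕ} (f : Equiv.Perm (Fin (n + 1)) → K) :
    ∑ σ, f σ = ∑ p, ∑ e, f (Equiv.Perm.decomposeFin.symm (p, e)) := by
  rw [← Fintype.sum_prod_type']
  exact (Equiv.sum_comp Equiv.Perm.decomposeFin.symm f).symm

lemma SchurGood.comp {n k : ℕ} {y : Fin n → K} (hy : SchurGood y) {g : Fin k → Fin n}
    (hg : Function.Injective g) : SchurGood (fun i => y (g i)) :=
  fun i j h => hy _ _ (hg.ne h)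

lemma schur_perm_sum (h2 : (2 : K) ≠ 0) (m : ℕ) : ∀ (y : Fin (2 * m) → K), SchurGood y →
    ∑ σ : Equiv.Perm (Fin (2 * m)), schurH (fun i => y (σ i)) =
      ((2 ^ m * Nat.factorial m : ℕ) : K) := by
  induction m with
  | zero =>
    intro y _
    have : ∀ σ : Equiv.Perm (Fin (2 * 0)), schurH (fun i => y (σ i)) = 1 := by
      intro σ
      simp [schurH, schurP]
    simp_rw [this]
    simp
  | succ m ih =>
    intro y hy
    change ∑ σ : Equiv.Perm (Fin (2 * m + 1 + 1)), schurH (m := m + 1) (fun i => y (σ i)) = _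
    rw [sum_perm_succ]
    have hp : ∀ p : Fin (2 * m + 1 + 1), ∑ e : Equiv.Perm (Fin (2 * m + 1)),
        schurH (m := m + 1) (fun i => y (Equiv.Perm.decomposeFin.symm (p, e) i)) =
        ((2 ^ m * Nat.factorial m : ℕ) : K) := by
      intro p
      rw [sum_perm_succ]
      set z : Fin (2 * m + 1) → K := fun k => y (Equiv.swap 0 p k.succ) with hzdef
      have hz : SchurGood z := hy.comp
        (g := fun k : Fin (2 * m + 1) => (Equiv.swap 0 p k.succ : Fin (2 * m + 1 + 1)))
        (fun a b h => by simpa using h)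
      have hyz : ∀ k, z k + y p ≠ 0 ∧ y p ≠ z k := by
        intro k
        have hne : Equiv.swap 0 p k.succ ≠ p := by
          intro h
          have := congrArg (Equiv.swap 0 p) h
          simp at this
        exact ⟨(hy _ _ hne).2, (hy _ _ hne).1.symm⟩
      have hTz : ∀ k, schurT (y p) (z k) ≠ 0 := fun k =>
        div_ne_zero (sub_ne_zero.mpr (hyz k).2.symm) (hyz k).1
      have hq : ∀ q : Fin (2 * m + 1), ∑ e : Equiv.Perm (Fin (2 * m)),
          schurH (m := m + 1) (fun i => y (Equiv.Perm.decomposeFin.symm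
            (p, Equiv.Perm.decomposeFin.symm (q, e)) i)) =
          ((2 ^ m * Nat.factorial m : ℕ) : K) * ((∏ k, schurT (y p) (z k))⁻¹ *
            (schurT (y p) (z q) * ∏ k ∈ Finset.univ.erase q, (schurT (z q) (z k))⁻¹)) := by
        intro q
        set w : Fin (2 * m) → K := fun k => z (Equiv.swap 0 q k.succ) with hwdef
        have hw : SchurGood w := hz.comp
          (g := fun k : Fin (2 * m) => (Equiv.swap 0 q k.succ : Fin (2 * m + 1)))
          (fun a b h => by simpa using h)
        have hterm : ∀ e : Equiv.Perm (Fin (2 * m)),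
            schurH (m := m + 1) (fun i => y (Equiv.Perm.decomposeFin.symm
              (p, Equiv.Perm.decomposeFin.symm (q, e)) i)) =
            schurH (fun i => w (e i)) *
              ∏ k, ((schurT (y p) (w k))⁻¹ * (schurT (z q) (w k))⁻¹) := by
          intro e
          rw [schurH_succ _ (hy.comp (Equiv.injective _))]
          have h0 : y ((Equiv.Perm.decomposeFin.symm
              (p, Equiv.Perm.decomposeFin.symm (q, e))) (0 : Fin (2 * m + 1 + 1))) = y p := by
            rw [Equiv.Perm.decomposeFin_symm_apply_zero]
          have h1 : y ((Equiv.Perm.decomposeFin.symm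
              (p, Equiv.Perm.decomposeFin.symm (q, e))) (Fin.succ (0 : Fin (2 * m + 1)))) =
              z q := by
            rw [Equiv.Perm.decomposeFin_symm_apply_succ,
              Equiv.Perm.decomposeFin_symm_apply_zero]
          have h2 : ∀ k : Fin (2 * m), y ((Equiv.Perm.decomposeFin.symm
              (p, Equiv.Perm.decomposeFin.symm (q, e))) k.succ.succ) = w (e k) := by
            intro k
            rw [Equiv.Perm.decomposeFin_symm_apply_succ,
              Equiv.Perm.decomposeFin_symm_apply_succ]
          simp only [h2]
          erw [h0, h1]
          congr 1
          exact Equiv.prod_comp e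
            (fun k => (schurT (y p) (w k))⁻¹ * (schurT (z q) (w k))⁻¹)
        rw [Finset.sum_congr rfl (fun e _ => hterm e), ← Finset.sum_mul, ih w hw]
        congr 1
        rw [Finset.prod_mul_distrib,
          prod_swap_succ q (fun k => (schurT (y p) (z k))⁻¹),
          prod_swap_succ q (fun k => (schurT (z q) (z k))⁻¹),
          ← Finset.mul_prod_erase Finset.univ _ (Finset.mem_univ q), Finset.prod_inv_distrib]
        have := hTz q
        rw [mul_inv]
        field_simp
      rw [Finset.sum_congr rfl (fun q _ => hq q), ← Finset.mul_sum, ← Finset.mul_sum,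
        schur_main h2 m (y p) z (fun i j h => by
          by_contra hij; exact (hz i j hij).1 h) (fun i => (hyz i).1),
        inv_mul_cancel₀ (Finset.prod_ne_zero_iff.mpr fun k _ => hTz k), mul_one]
    rw [Finset.sum_congr rfl (fun p _ => hp p)]
    simp only [Finset.sum_const, Finset.card_univ, Fintype.card_fin, nsmul_eq_mul,
      Nat.factorial_succ]
    push_cast
    ring

lemma schur_pfaffian [CharZero K] (m : ℕ) (y : Fin (2 * m) → K) (hy : SchurGood y) :
    pfaffian (fun i j => schurT (y i) (y j)) = schurP y := by
  have hne : schurP y ≠ 0 := by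
    unfold schurP
    refine Finset.prod_ne_zero_iff.mpr fun i _ => Finset.prod_ne_zero_iff.mpr fun j hj => ?_
    exact schurT_ne hy (Finset.mem_Ioi.mp hj).ne
  have hc : ((2 ^ m * Nat.factorial m : ℕ) : K) ≠ 0 := by
    have := Nat.factorial_ne_zero m
    exact_mod_cast (by positivity : 2 ^ m * Nat.factorial m ≠ 0)
  unfold pfaffian
  rw [div_eq_iff hc, ← schur_perm_sum two_ne_zero m y hy, Finset.mul_sum]
  refine Finset.sum_congr rfl fun σ _ => ?_
  have hs : schurP (fun i => y (σ i)) = ((Equiv.Perm.sign σ : ℤ) : K) * schurP y :=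
    Equiv.Perm.prod_Ioi_comp_eq_sign_mul_prod σ (f := fun i j => schurT (y i) (y j))
      (fun i j => by unfold schurT; rw [← neg_div, neg_sub, add_comm])
  unfold schurH
  rw [hs]
  rcases Int.units_eq_one_or (Equiv.Perm.sign σ) with h | h <;> rw [h] <;> push_cast <;>
    field_simp

lemma schurP_shift (c : ℕ → K) (N : ℕ) : ∀ s : ℕ,
    schurP (fun p : Fin N => c (p.val + s)) =
      ∏ i ∈ Finset.Ico s (s + N), ∏ j ∈ Finset.Ioo i (s + N), schurT (c i) (c j) := by
  induction N with
  | zero => intro s; simp [schurP]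
  | succ N ih =>
    intro s
    rw [schurP_succ, Finset.prod_eq_prod_Ico_succ_bot (by omega)]
    have h := ih (s + 1)
    rw [show s + 1 + N = s + (N + 1) by ring] at h
    rw [← h]
    congr 1
    · have : Finset.Ioo s (s + (N + 1)) = Finset.Ico (s + 1) (s + (N + 1)) := by
        ext x; simp only [Finset.mem_Ioo, Finset.mem_Ico]; omega
      rw [this, Finset.prod_Ico_eq_prod_range,
        ← Fin.prod_univ_eq_prod_range (fun k => schurT (c s) (c (s + 1 + k))),
        show s + (N + 1) - (s + 1) = N by omega]
      refine Finset.prod_congr rfl fun k _ => ?_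
      simp only [Fin.val_zero, Fin.val_succ, zero_add]
      rw [show k.val + 1 + s = s + 1 + k.val by ring]
    · congr 1
      funext k
      simp only [Fin.val_succ]
      rw [show k.val + 1 + s = k.val + (s + 1) by ring]

end SchurHelpers

lemma xx_ne (p : MvPolynomial ℕ ℚ) (f : ℕ → ℚ) (h : MvPolynomial.eval f p ≠ 0) :
    algebraMap (MvPolynomial ℕ ℚ) KK p ≠ 0 := by
  intro h0
  rw [FaithfulSMul.algebraMap_eq_zero_iff] at h0
  exact h (by rw [h0]; simp)

lemma xx_sub_ne {i j : ℕ} (h : i ≠ j) : xx i - xx j ≠ 0 := by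
  have := xx_ne (MvPolynomial.X i - MvPolynomial.X j) (fun k => if k = i then 1 else 0)
    (by simp [h.symm])
  simpa [xx] using this

lemma one_sub_xx_ne (i : ℕ) : 1 - xx i ≠ 0 := by
  have := xx_ne (1 - MvPolynomial.X i) 0 (by simp)
  simpa [xx] using this

lemma one_add_xx_ne (i : ℕ) : 1 + xx i ≠ 0 := by
  have := xx_ne (1 + MvPolynomial.X i) 0 (by simp)
  simpa [xx] using this

lemma one_sub_xx_mul_ne (i j : ℕ) : 1 - xx i * xx j ≠ 0 := by
  have := xx_ne (1 - MvPolynomial.X i * MvPolynomial.X j) 0 (by simp)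
  simpa [xx] using this

/-- The Cayley transform of the indeterminates, with value `0` at the label `0`. -/
def cay (l : ℕ) : KK := if l = 0 then 0 else (1 + xx l) / (1 - xx l)

lemma cay_sub {p q : ℕ} (hp : p ≠ 0) (hq : q ≠ 0) :
    cay q - cay p = 2 * (xx q - xx p) / ((1 - xx p) * (1 - xx q)) := by
  have h1 := one_sub_xx_ne p
  have h2 := one_sub_xx_ne q
  simp only [cay, hp, hq, if_false]
  field_simp
  ring

lemma cay_add {p q : ℕ} (hp : p ≠ 0) (hq : q ≠ 0) :
    cay q + cay p = 2 * (1 - xx p * xx q) / ((1 - xx p) * (1 - xx q)) := by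
  have h1 := one_sub_xx_ne p
  have h2 := one_sub_xx_ne q
  simp only [cay, hp, hq, if_false]
  field_simp
  ring

lemma cay_ne {p : ℕ} (hp : p ≠ 0) : cay p ≠ 0 := by
  simp only [cay, hp, if_false]
  exact div_ne_zero (one_add_xx_ne p) (one_sub_xx_ne p)

lemma cay_good {p q : ℕ} (h : p ≠ q) : cay p ≠ cay q ∧ cay p + cay q ≠ 0 := by
  by_cases hp : p = 0
  · subst hp
    have := cay_ne h.symm
    have h0 : cay 0 = 0 := by simp [cay]
    rw [h0]
    exact ⟨this.symm, by simpa using this⟩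
  by_cases hq : q = 0
  · subst hq
    have := cay_ne h
    have h0 : cay 0 = 0 := by simp [cay]
    rw [h0]
    exact ⟨this, by simpa using this⟩
  have hd := mul_ne_zero (one_sub_xx_ne q) (one_sub_xx_ne p)
  constructor
  · rw [← sub_ne_zero, cay_sub hq hp]
    exact div_ne_zero (mul_ne_zero two_ne_zero (xx_sub_ne h)) hd
  · rw [cay_add hq hp]
    exact div_ne_zero (mul_ne_zero two_ne_zero (one_sub_xx_mul_ne q p)) hd

lemma schurT_cay {p q : ℕ} (h : p < q) : schurT (cay p) (cay q) =
    if p = 0 then 1 else (xx q - xx p) / (1 - xx p * xx q) := by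
  have hq : q ≠ 0 := by omega
  unfold schurT
  split_ifs with hp
  · subst hp
    have h0 : cay 0 = 0 := by simp [cay]
    rw [h0, sub_zero, add_zero, div_self (cay_ne hq)]
  · have h1 := one_sub_xx_ne p
    have h2 := one_sub_xx_ne q
    have h3 := one_sub_xx_mul_ne p q
    rw [cay_sub hp hq, cay_add hp hq]
    field_simp

lemma schurP_cay (n : ℕ) : schurP (fun p : Fin (2 * ((n + 1) / 2)) => cay (lab n p)) =
    ∏ i ∈ Finset.Icc 1 n, ∏ j ∈ Finset.Ioc i n, (xx j - xx i) / (1 - xx i * xx j) := by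
  have hfin : ∏ i ∈ Finset.Ico 1 (n + 1), ∏ j ∈ Finset.Ioo i (n + 1), schurT (cay i) (cay j) =
      ∏ i ∈ Finset.Icc 1 n, ∏ j ∈ Finset.Ioc i n, (xx j - xx i) / (1 - xx i * xx j) := by
    refine Finset.prod_congr (by ext; simp only [Finset.mem_Ico, Finset.mem_Icc]; omega)
      fun i hi => ?_
    refine Finset.prod_congr (by ext; simp only [Finset.mem_Ioo, Finset.mem_Ioc]; omega)
      fun j hj => ?_
    have hi := (Finset.mem_Icc.mp hi).1
    rw [schurT_cay (Finset.mem_Ioc.mp hj).1, if_neg (by omega)]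
  rw [← hfin]
  by_cases h : Even n
  · simp only [lab, h, if_true]
    rw [schurP_shift cay _ 1]
    have hN : 1 + 2 * ((n + 1) / 2) = n + 1 := by
      obtain ⟨k, rfl⟩ := h
      omega
    rw [hN]
  · simp only [lab, h, if_false]
    have h0 := schurP_shift cay (2 * ((n + 1) / 2)) 0
    simp only [add_zero] at h0
    rw [h0]
    have hN : 0 + 2 * ((n + 1) / 2) = n + 1 := by
      obtain ⟨k, rfl⟩ := Nat.not_even_iff_odd.mp h
      omega
    rw [hN, Finset.prod_eq_prod_Ico_succ_bot (by omega)]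
    have : ∏ j ∈ Finset.Ioo 0 (n + 1), schurT (cay 0) (cay j) = 1 :=
      Finset.prod_eq_one fun j hj => by
        rw [schurT_cay (Finset.mem_Ioo.mp hj).1, if_pos rfl]
    rw [this, one_mul]


/-- Schur's Pfaffian identity (Cayley–Möbius form):
`pf_{χ_even(n) ≤ i < j ≤ n}(a_{ij}) = ∏_{1≤i<j≤n} (x_j - x_i)/(1 - x_i x_j)`
where `a_{0j} = 1` and `a_{ij} = (x_j - x_i)/(1 - x_i x_j)` for `i ≥ 1`,
in `ℚ(x_1,…,x_n)`. -/
theorem stmt11 (n : ℕ) (hn : 0 < n) :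
    pfaffian (pfArray n (fun p q => if p = 0 then 1 else (xx q - xx p) / (1 - xx p * xx q)))
    = ∏ i ∈ Finset.Icc 1 n, ∏ j ∈ Finset.Ioc i n, (xx j - xx i) / (1 - xx i * xx j) := by
  have hA : pfArray n (fun p q => if p = 0 then 1 else (xx q - xx p) / (1 - xx p * xx q)) =
      fun i j : Fin (2 * ((n + 1) / 2)) => schurT (cay (lab n i)) (cay (lab n j)) := by
    funext i j
    unfold pfArray
    split_ifs with h1 h2
    · exact (schurT_cay h1).symm
    · beta_reduce
      rw [← schurT_cay h2]
      unfold schurT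
      rw [← neg_div, neg_sub, add_comm (cay (lab n i))]
    · have : lab n i = lab n j := by omega
      rw [this]
      simp [schurT]
  rw [hA, schur_pfaffian ((n + 1) / 2) (fun p => cay (lab n p)), schurP_cay]
  intro i j hij
  apply cay_good
  have : i.val ≠ j.val := fun h => hij (Fin.ext h)
  unfold lab
  split_ifs <;> omega

end
end

section
/- (Classical Littlewood identity) The sum of Schur polynomials s_λ(x_1,...,x_n) over all partitions λ with at most n parts equals ∏_{i=1}^{n} 1/(1 - x_i) · ∏_{1 ≤ i < j ≤ n} 1/(1 - x_i x_j), as formal power series in ℚ[[x_1,...,x_n]]. -/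
open Polynomial in
theorem lw_quot {K : Type*} [CommRing K] [IsDomain K] (n : ℕ) (x : Fin (n + 1) → K)
    (hx : ∀ i, 1 + x i ≠ 0) :
    ∃ c : ℕ → K, c 0 = 1 - ∏ i, x i ∧ ∀ k : Fin (n + 1),
      (1 - x k) * ∏ i : Fin n, (1 - x (k.succAbove i) * x k)
        = ∑ j ∈ Finset.range (n + 1), c j * x k ^ j := by
  set P : K[X] := (∏ l, (1 - C (x l) * X)) - ∏ l, (C (x l) - X) with hP
  have hroot : P.IsRoot (-1) := by
    simp [hP, IsRoot, eval_prod, add_comm]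
  obtain ⟨q, hq⟩ := dvd_iff_isRoot.mpr hroot
  have hdegP : P.natDegree ≤ n + 1 := by
    refine (natDegree_sub_le _ _).trans (max_le ?_ ?_)
    · refine (natDegree_prod_le _ _).trans ?_
      refine (Finset.sum_le_card_nsmul _ _ 1 ?_).trans (by simp)
      intro i _
      compute_degree
    · refine (natDegree_prod_le _ _).trans ?_
      refine (Finset.sum_le_card_nsmul _ _ 1 ?_).trans (by simp)
      intro i _
      compute_degree
  have hdeg : q.natDegree < n + 1 := by
    by_cases h0 : q = 0
    · simp [h0]
    · have := (monic_X_sub_C (-1 : K)).natDegree_mul' h0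
      rw [← hq, natDegree_X_sub_C] at this
      omega
  refine ⟨q.coeff, ?_, ?_⟩
  · have := congrArg (eval 0) hq
    simp [hP, eval_prod] at this
    rw [coeff_zero_eq_eval_zero, ← this]
  · intro k
    rw [← eval_eq_sum_range' hdeg]
    have := congrArg (eval (x k)) hq
    simp only [hP, eval_sub, eval_prod, eval_mul, eval_C, eval_X, eval_one] at this
    rw [Finset.prod_eq_zero (f := fun l => x l - x k) (Finset.mem_univ k) (by simp),
      Fin.prod_univ_succAbove _ k] at this
    apply mul_left_cancel₀ (hx k)
    linear_combination this

theorem lw_det {K : Type*} [CommRing K] [IsDomain K] (n : ℕ) (x : Fin (n + 1) → K)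
    (hx : ∀ i, 1 + x i ≠ 0) :
    ∑ k : Fin (n + 1), (-1) ^ ((k : ℕ) + n) *
      ((1 - x k) * ∏ i : Fin n, (1 - x (k.succAbove i) * x k)) *
      ((∏ i : Fin n, x (k.succAbove i)) *
        Matrix.det (Matrix.of fun i j : Fin n => x (k.succAbove i) ^ (n - 1 - (j : ℕ))))
    = (1 - ∏ i, x i) * Matrix.det (Matrix.of fun i j : Fin (n + 1) =>
        x i ^ (n + 1 - 1 - (j : ℕ))) := by
  obtain ⟨c, hc0, hc⟩ := lw_quot n x hx
  have key := Matrix.det_updateCol_sum (Matrix.of fun i j : Fin (n + 1) =>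
        x i ^ (n + 1 - 1 - (j : ℕ))) (Fin.last n) (fun j => c (n - j))
  simp only [Fin.val_last, Nat.sub_self, hc0, smul_eq_mul] at key
  rw [← key, Matrix.det_succ_column _ (Fin.last n)]
  refine Finset.sum_congr rfl fun k _ => ?_
  congr 1
  · rw [Matrix.updateCol_self, hc, Finset.sum_range, ← Equiv.sum_comp Fin.revPerm]
    simp only [Fin.val_last, Matrix.of_apply]
    congr 1
    refine Finset.sum_congr rfl fun j _ => ?_
    simp [Fin.val_rev]
  · rw [← Matrix.det_mul_column]
    congr 1
    ext i j
    have : n - (j : ℕ) = (n - 1 - j) + 1 := by omega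
    simp [(Fin.castSucc_lt_last j).ne, this, pow_succ']

theorem lw_prod {K : Type*} [CommRing K] (n : ℕ) (x : Fin (n + 1) → K) (k : Fin (n + 1)) :
    (∏ i, (1 - x i)) * ∏ i, ∏ j ∈ Finset.univ.filter (fun j => i < j), (1 - x i * x j)
    = ((1 - x k) * ∏ i : Fin n, (1 - x (k.succAbove i) * x k)) *
      ((∏ i : Fin n, (1 - x (k.succAbove i))) *
        ∏ i : Fin n, ∏ j ∈ Finset.univ.filter (fun j => i < j),
          (1 - x (k.succAbove i) * x (k.succAbove j))) := by
  simp only [Finset.prod_filter]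
  rw [Fin.prod_univ_succAbove (fun i => 1 - x i) k, Fin.prod_univ_succAbove _ k]
  have h1 : ∀ i : Fin n, (∏ j, if k.succAbove i < j then 1 - x (k.succAbove i) * x j else 1)
      = (if k.succAbove i < k then 1 - x (k.succAbove i) * x k else 1) *
        ∏ j, if i < j then 1 - x (k.succAbove i) * x (k.succAbove j) else 1 := by
    intro i
    rw [Fin.prod_univ_succAbove _ k]
    simp
  rw [Finset.prod_congr rfl fun i _ => h1 i, Finset.prod_mul_distrib,
    Fin.prod_univ_succAbove (fun j => if k < j then 1 - x k * x j else 1) k]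
  have h2 : (∏ i : Fin n, (1 - x (k.succAbove i) * x k)) =
     (∏ i : Fin n, if k < k.succAbove i then 1 - x k * x (k.succAbove i) else 1) *
     (∏ i : Fin n, if k.succAbove i < k then 1 - x (k.succAbove i) * x k else 1) := by
    rw [← Finset.prod_mul_distrib]
    refine Finset.prod_congr rfl fun i _ => ?_
    rcases lt_or_gt_of_ne (Fin.succAbove_ne k i) with h | h
    · simp [h, h.not_gt]
    · simp [h, h.not_gt, mul_comm]
  rw [h2]
  simp
  ring

open MvPowerSeries MvPowerSeries.WithPiTopology

instance lw_dom {σ : Type*} : IsDomain (MvPowerSeries σ ℚ) := NoZeroDivisors.to_isDomain _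

noncomputable def lwAlt {σ : Type*} {n : ℕ} (e : Fin n → σ) (lam : Fin n → ℕ) :
    MvPowerSeries σ ℚ :=
  Matrix.det (Matrix.of fun i j : Fin n =>
    (MvPowerSeries.X (e i) : MvPowerSeries σ ℚ) ^ (lam j + (n - 1 - (j : ℕ))))

theorem lw_order {σ : Type*} {n : ℕ} (e : Fin n → σ) (lam : Fin n → ℕ) (i : Fin n) :
    (lam i : ℕ∞) ≤ (lwAlt e lam).order := by
  refine le_order fun d hd => ?_
  have hd' : d.degree < lam i := by exact_mod_cast hd
  unfold lwAlt
  rw [Matrix.det_apply', map_sum]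
  refine Finset.sum_eq_zero fun τ _ => ?_
  have : (X (e (τ i)) : MvPowerSeries σ ℚ) ^ (lam i + (n - 1 - (i : ℕ))) ∣
    ((Equiv.Perm.sign τ : ℤ) : MvPowerSeries σ ℚ) * ∏ j, Matrix.of (fun i j : Fin n =>
    (MvPowerSeries.X (e i) : MvPowerSeries σ ℚ) ^ (lam j + (n - 1 - (j : ℕ)))) (τ j) j := by
    apply Dvd.dvd.mul_left
    exact Finset.dvd_prod_of_mem (fun j => Matrix.of (fun i j : Fin n =>
    (MvPowerSeries.X (e i) : MvPowerSeries σ ℚ) ^ (lam j + (n - 1 - (j : ℕ)))) (τ j) j)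
      (Finset.mem_univ i)
  refine X_pow_dvd_iff.mp this d ?_
  have := Finsupp.le_degree (e (τ i)) d
  omega

theorem lw_summable {σ : Type*} {n : ℕ} (F : {f : Fin n → ℕ // Antitone f} → MvPowerSeries σ ℚ)
    (c : ℕ) (h : ∀ lam i, (lam.1 i : ℕ∞) ≤ (F lam).order + c) : Summable F := by
  rw [summable_iff_summable_coeff]
  intro d
  refine summable_of_hasFiniteSupport ?_
  have hfin : (Set.Iic (fun _ : Fin n => d.degree + c)).Finite := Set.finite_Iic _
  refine (hfin.preimage (f := Subtype.val) Subtype.val_injective.injOn).subset ?_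
  intro lam hlam i
  have h1 : (F lam).order ≤ d.degree := order_le hlam
  have h2 := (h lam i).trans (add_le_add_left h1 _)
  exact_mod_cast h2

def lwZero {n : ℕ} (lam : {f : Fin n → ℕ // Antitone f}) :
    {f : Fin (n + 1) → ℕ // Antitone f} :=
  ⟨Fin.snoc (α := fun _ => ℕ) lam.1 0, by
    intro i j hij
    induction j using Fin.lastCases with
    | last => simp
    | cast j =>
      induction i using Fin.lastCases with
      | last => exact absurd hij (by simp)
      | cast i => simpa using lam.2 (by simpa using hij)⟩

def lwSucc {n : ℕ} (lam : {f : Fin n → ℕ // Antitone f}) :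
    {f : Fin n → ℕ // Antitone f} :=
  ⟨fun i => lam.1 i + 1, fun _ _ hij => Nat.add_le_add_right (lam.2 hij) 1⟩

theorem lwZero_inj {n : ℕ} : Function.Injective (lwZero (n := n)) := by
  intro a b h
  have h' := congrArg Subtype.val h
  ext i
  have := congrFun h' i.castSucc
  simpa [lwZero] using this

theorem lwSucc_inj {n : ℕ} : Function.Injective (lwSucc (n := n)) := by
  intro a b h
  have h' := congrArg Subtype.val h
  ext i
  have := congrFun h' i
  simpa [lwSucc] using this

theorem lw_compl {n : ℕ} : IsCompl (Set.range (lwZero (n := n))) (Set.range (lwSucc (n := n + 1))) := by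
  rw [isCompl_iff, Set.disjoint_iff_inter_eq_empty, codisjoint_iff]
  constructor
  · ext f
    simp only [Set.mem_inter_iff, Set.mem_range, Set.mem_empty_iff_false, iff_false]
    rintro ⟨⟨a, rfl⟩, ⟨b, hb⟩⟩
    have := congrFun (congrArg Subtype.val hb) (Fin.last n)
    simp [lwZero, lwSucc] at this
  · change _ ∪ _ = Set.univ
    ext f
    simp only [Set.mem_union, Set.mem_range, Set.mem_univ, iff_true]
    by_cases h : f.1 (Fin.last n) = 0
    · left
      refine ⟨⟨fun i => f.1 i.castSucc, fun i j hij => f.2 (by simpa using hij)⟩, ?_⟩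
      ext i
      induction i using Fin.lastCases with
      | last => simp [lwZero, h]
      | cast i => simp [lwZero]
    · right
      refine ⟨⟨fun i => f.1 i - 1, fun i j hij => Nat.sub_le_sub_right (f.2 hij) 1⟩, ?_⟩
      ext i
      have := f.2 (Fin.le_last i)
      simp only [lwSucc]
      omega

theorem lw_split {n : ℕ} {M : Type*} [AddCommMonoid M] [TopologicalSpace M] [ContinuousAdd M]
    (F : {f : Fin (n + 1) → ℕ // Antitone f} → M) (a b : M)
    (h0 : HasSum (fun lam => F (lwZero lam)) a) (h1 : HasSum (fun lam => F (lwSucc lam)) b) :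
    HasSum F (a + b) :=
  HasSum.add_isCompl lw_compl
    (lwZero_inj.hasSum_range_iff.mpr h0) (lwSucc_inj.hasSum_range_iff.mpr h1)

theorem lwAlt_succ {σ : Type*} {n : ℕ} (e : Fin n → σ) (lam : {f : Fin n → ℕ // Antitone f}) :
    lwAlt e (lwSucc lam).1 = (∏ i, X (e i)) * lwAlt e lam.1 := by
  unfold lwAlt
  rw [← Matrix.det_mul_column]
  congr 1
  ext i j : 2
  simp only [lwSucc, Matrix.of_apply]
  ring

theorem lwAlt_zero {σ : Type*} {n : ℕ} (e : Fin (n + 1) → σ)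
    (lam : {f : Fin n → ℕ // Antitone f}) :
    lwAlt e (lwZero lam).1 = ∑ k : Fin (n + 1), ((-1) ^ ((k : ℕ) + n) *
      ∏ i : Fin n, X (e (k.succAbove i))) * lwAlt (fun i => e (k.succAbove i)) lam.1 := by
  unfold lwAlt
  rw [Matrix.det_succ_column _ (Fin.last n)]
  refine Finset.sum_congr rfl fun k _ => ?_
  rw [mul_assoc, mul_assoc, ← Matrix.det_mul_column]
  simp only [Matrix.of_apply, lwZero, Fin.snoc_last, Fin.val_last]
  rw [show 0 + (n + 1 - 1 - n) = 0 by omega, pow_zero, one_mul]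
  congr 2
  ext i j : 2
  have : n - (j : ℕ) = (n - 1 - j) + 1 := by omega
  simp [this, ← pow_succ', ← add_assoc]

theorem lw_main {σ : Type*} : ∀ (n : ℕ) (e : Fin n → σ),
    (∑' lam : {f : Fin n → ℕ // Antitone f}, lwAlt e lam.1) *
      ((∏ i, (1 - X (e i))) * ∏ i, ∏ j ∈ Finset.univ.filter (fun j => i < j),
        (1 - X (e i) * X (e j)))
    = Matrix.det (Matrix.of fun i j : Fin n =>
            (X (e i) : MvPowerSeries σ ℚ) ^ (n - 1 - (j : ℕ))) := by
  intro n
  induction n with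
  | zero =>
    intro e
    have : Unique {f : Fin 0 → ℕ // Antitone f} :=
      ⟨⟨⟨fun _ => 0, fun _ _ _ => le_rfl⟩⟩, fun a => by ext i; exact i.elim0⟩
    have := (hasSum_unique (fun lam : {f : Fin 0 → ℕ // Antitone f} => lwAlt e lam.1)).tsum_eq
    rw [this]
    simp [lwAlt]
  | succ n ih =>
    intro e
    have hsum : ∀ {m : ℕ} (e : Fin m → σ),
        Summable (fun lam : {f : Fin m → ℕ // Antitone f} => lwAlt e lam.1) := fun e =>
      lw_summable _ 0 fun lam i => by simpa using lw_order e lam.1 i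
    set A := ∑' lam : {f : Fin (n + 1) → ℕ // Antitone f}, lwAlt e lam.1 with hA
    have h0 : HasSum (fun lam : {f : Fin n → ℕ // Antitone f} => lwAlt e (lwZero lam).1)
        (∑ k : Fin (n + 1), ((-1) ^ ((k : ℕ) + n) *
          ∏ i : Fin n, X (e (k.succAbove i))) *
          ∑' lam : {f : Fin n → ℕ // Antitone f}, lwAlt (fun i => e (k.succAbove i)) lam.1) := by
      simp only [lwAlt_zero]
      refine hasSum_sum fun k _ => ?_
      have := (hsum (fun i => e (k.succAbove i))).hasSum
      exact this.mul_left _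
    have h1 : HasSum (fun lam : {f : Fin (n + 1) → ℕ // Antitone f} => lwAlt e (lwSucc lam).1)
        ((∏ i, X (e i)) * A) := by
      simp only [lwAlt_succ]
      exact (hsum _).hasSum.mul_left _
    have h2 := lw_split (fun lam : {f : Fin (n + 1) → ℕ // Antitone f} => lwAlt e lam.1)
      _ _ h0 h1
    have h3 := h2.tsum_eq
    rw [← hA] at h3
    have hne : (1 - ∏ i, X (e i) : MvPowerSeries σ ℚ) ≠ 0 := by
      intro h
      have := congrArg constantCoeff h
      simp [Fin.prod_univ_succ] at this
    have hx : ∀ i, (1 + X (e i) : MvPowerSeries σ ℚ) ≠ 0 := by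
      intro i h
      have := congrArg constantCoeff h
      simp at this
    apply mul_left_cancel₀ hne
    rw [← lw_det n (fun i => (X (e i) : MvPowerSeries σ ℚ)) hx]
    rw [← mul_assoc]
    rw [show (1 - ∏ i, X (e i)) * A = ∑ k : Fin (n + 1), ((-1) ^ ((k : ℕ) + n) *
          ∏ i : Fin n, X (e (k.succAbove i))) *
          ∑' lam : {f : Fin n → ℕ // Antitone f}, lwAlt (fun i => e (k.succAbove i)) lam.1 by
        linear_combination h3]
    rw [Finset.sum_mul]
    refine Finset.sum_congr rfl fun k _ => ?_
    rw [lw_prod n (fun i => (X (e i) : MvPowerSeries σ ℚ)) k]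
    rw [← ih (fun i => e (k.succAbove i))]
    ring

/-- The classical Littlewood identity: the sum of the Schur polynomials
`s_λ(x_1,…,x_n)` over all partitions `λ` with at most `n` parts equals
`∏_i 1/(1-x_i) ∏_{i<j} 1/(1-x_i x_j)` in `ℚ[[x_1,…,x_n]]`.

Here `s : (Fin n → ℕ) → MvPolynomial (Fin n) ℚ` is any family satisfying the
bialternant characterization
`s_λ · det(x_i^{n-j}) = det(x_i^{λ_j + n - j})` for weakly decreasing `λ`
(such a family exists: the Schur polynomials), and the summation of the family
over all partitions is expressed by `HasSum` for the coefficientwise (product)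
topology on `ℚ[[x_1,…,x_n]]`. -/
theorem stmt13 (n : ℕ) (hn : 0 < n)
    (s : (Fin n → ℕ) → MvPolynomial (Fin n) ℚ)
    (hs : ∀ lam : Fin n → ℕ, Antitone lam →
      s lam *
          Matrix.det (Matrix.of fun i j : Fin n =>
            (MvPolynomial.X i : MvPolynomial (Fin n) ℚ) ^ (n - 1 - (j : ℕ)))
        = Matrix.det (Matrix.of fun i j : Fin n =>
            (MvPolynomial.X i : MvPolynomial (Fin n) ℚ) ^ (lam j + (n - 1 - (j : ℕ))))) :
    letI : TopologicalSpace (MvPowerSeries (Fin n) ℚ) :=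
      inferInstanceAs (TopologicalSpace ((Fin n →₀ ℕ) → ℚ))
    HasSum
      (fun lam : {f : Fin n → ℕ // Antitone f} =>
        ((s lam.1 : MvPolynomial (Fin n) ℚ) : MvPowerSeries (Fin n) ℚ))
      ((∏ i : Fin n, (1 - MvPowerSeries.X i : MvPowerSeries (Fin n) ℚ)⁻¹) *
        ∏ i : Fin n, ∏ j ∈ Finset.univ.filter (fun j => i < j),
          (1 - MvPowerSeries.X i * MvPowerSeries.X j : MvPowerSeries (Fin n) ℚ)⁻¹) := by
  set V : MvPowerSeries (Fin n) ℚ := Matrix.det (Matrix.of fun i j : Fin n =>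
            (X i : MvPowerSeries (Fin n) ℚ) ^ (n - 1 - (j : ℕ))) with hV
  have hV0 : V ≠ 0 := by
    have h1 : (Matrix.of fun i j : Fin n => (X i : MvPowerSeries (Fin n) ℚ) ^ (n - 1 - (j : ℕ)))
        = (Matrix.vandermonde (fun i => (X i : MvPowerSeries (Fin n) ℚ))).submatrix id
          Fin.revPerm := by
      ext i j : 2
      simp only [Matrix.vandermonde, Matrix.of_apply, Matrix.submatrix_apply, id, Fin.revPerm_apply, Fin.val_rev]
      rw [show n - 1 - (j : ℕ) = n - (j + 1) by omega]
    rw [hV, h1, Matrix.det_permute']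
    refine mul_ne_zero ?_ (Matrix.det_vandermonde_ne_zero_iff.mpr ?_)
    · rcases Int.units_eq_one_or (Equiv.Perm.sign (Fin.revPerm : Equiv.Perm (Fin n))) with h | h <;>
        simp [h]
    · exact fun i j h => MvPowerSeries.X_inj.mp h
  have hs' : ∀ lam : {f : Fin n → ℕ // Antitone f},
      ((s lam.1 : MvPolynomial (Fin n) ℚ) : MvPowerSeries (Fin n) ℚ) * V = lwAlt id lam.1 := by
    intro lam
    have := congrArg (MvPolynomial.coeToMvPowerSeries.ringHom (R := ℚ)) (hs lam.1 lam.2)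
    rw [map_mul, RingHom.map_det, RingHom.map_det] at this
    have e1 : V = (MvPolynomial.coeToMvPowerSeries.ringHom.mapMatrix
        (Matrix.of fun i j : Fin n =>
          (MvPolynomial.X i : MvPolynomial (Fin n) ℚ) ^ (n - 1 - (j : ℕ)))).det := by
      rw [hV]
      congr 1
      ext i j : 2
      simp
    have e2 : lwAlt id lam.1 = (MvPolynomial.coeToMvPowerSeries.ringHom.mapMatrix
        (Matrix.of fun i j : Fin n =>
          (MvPolynomial.X i : MvPolynomial (Fin n) ℚ) ^ (lam.1 j + (n - 1 - (j : ℕ))))).det := by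
      unfold lwAlt
      congr 1
      ext i j : 2
      simp
    rw [e1, e2, ← this]
    rfl
  obtain ⟨c, hc⟩ : ∃ c : ℕ, (c : ℕ∞) = V.order := ⟨_, ne_zero_iff_order_finite.mp hV0⟩
  have hsum : Summable (fun lam : {f : Fin n → ℕ // Antitone f} =>
        ((s lam.1 : MvPolynomial (Fin n) ℚ) : MvPowerSeries (Fin n) ℚ)) := by
    refine lw_summable _ c fun lam i => ?_
    rw [hc, ← order_mul, hs']
    exact lw_order _ _ i
  have hA := (hsum.hasSum.mul_right V).tsum_eq
  simp only [hs'] at hA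
  have hmain := lw_main n (id : Fin n → Fin n)
  rw [hA] at hmain
  simp only [id] at hmain
  rw [← hV] at hmain
  have hcan : (∑' lam : {f : Fin n → ℕ // Antitone f},
        ((s lam.1 : MvPolynomial (Fin n) ℚ) : MvPowerSeries (Fin n) ℚ)) *
      ((∏ i, (1 - X i)) * ∏ i, ∏ j ∈ Finset.univ.filter (fun j => i < j),
        (1 - X i * X j)) = 1 := by
    apply mul_left_cancel₀ hV0
    linear_combination hmain
  have hinv : ((∏ i, (1 - X i)) * ∏ i, ∏ j ∈ Finset.univ.filter (fun j => i < j),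
        (1 - X i * X j)) * ((∏ i : Fin n, (1 - MvPowerSeries.X i : MvPowerSeries (Fin n) ℚ)⁻¹) *
        ∏ i : Fin n, ∏ j ∈ Finset.univ.filter (fun j => i < j),
          (1 - MvPowerSeries.X i * MvPowerSeries.X j : MvPowerSeries (Fin n) ℚ)⁻¹) = 1 := by
    rw [mul_mul_mul_comm, ← Finset.prod_mul_distrib, ← Finset.prod_mul_distrib]
    refine (congrArg₂ (· * ·) (Finset.prod_eq_one ?_) (Finset.prod_eq_one ?_)).trans (one_mul 1)
    rotate_left
    · intro i _
      rw [← Finset.prod_mul_distrib]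
      refine Finset.prod_eq_one fun j _ => ?_
      exact MvPowerSeries.mul_inv_cancel _ (by simp)
    · intro i _
      exact MvPowerSeries.mul_inv_cancel _ (by simp)
  have hfin := left_inv_eq_right_inv hcan hinv
  rw [← hfin]
  exact hsum.hasSum
end

section
/- Define F̃ as in the previous context. Then for n > 1 and each 1 ≤ i ≤ n-1, F̃(x_1,...,x_n)|_{x_n = x_i^{-1}} = ((w+2)/x_i^{n-2}) ∏_{k≠i, 1≤k≤n-1} (1 + w x_k + x_k x_i)(x_k + x_i + w x_k x_i) · F̃(x_1,...,x̂_i,...,x_{n-1}), where x̂_i denotes omission of x_i. -/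
noncomputable section

/-- `F(x_1,…,x_n) = asym[∏_{1≤i<j≤n}(x_i x_j + 1 + w x_i)
      ∏_{i=1}^n x_i^{i-1} (1 - ∏_{j=i}^n x_j)^{-1}] / ∏_{1≤i<j≤n}(x_j - x_i)`. -/
def Ffun {K : Type*} [Field K] (w : K) (n : ℕ) (x : Fin n → K) : K :=
  (∑ σ : Equiv.Perm (Fin n), ((Equiv.Perm.sign σ : ℤ) : K) *
      ((∏ i : Fin n, ∏ j ∈ Finset.univ.filter (fun j => i < j),
          (x (σ i) * x (σ j) + 1 + w * x (σ i))) *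
        ∏ i : Fin n, (x (σ i) ^ (i : ℕ) *
          (1 - ∏ j ∈ Finset.univ.filter (fun j => i ≤ j), x (σ j))⁻¹))) /
    ∏ i : Fin n, ∏ j ∈ Finset.univ.filter (fun j => i < j), (x j - x i)

/-- `F̃(x_1,…,x_n) = ∏_i (1-x_i) ∏_{i<j} (1 - x_i x_j) · F(x_1,…,x_n)`. -/
def Ftilde {K : Type*} [Field K] (w : K) (n : ℕ) (x : Fin n → K) : K :=
  (∏ i : Fin n, (1 - x i)) *
    (∏ i : Fin n, ∏ j ∈ Finset.univ.filter (fun j => i < j), (1 - x i * x j)) *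
    Ffun w n x

/-- The indeterminate `w`. -/
def ww : KK := algebraMap (MvPolynomial ℕ ℚ) KK (MvPolynomial.X 0)


/-- `f` is regular at `a` with value `v`. -/
def HasVal {K : Type*} [Field K] (a : K) (f : RatFunc K) (v : K) : Prop :=
  ∃ p q : Polynomial K, q.eval a ≠ 0 ∧
    f * algebraMap (Polynomial K) (RatFunc K) q = algebraMap (Polynomial K) (RatFunc K) p ∧
    v * q.eval a = p.eval a

namespace HasVal
variable {K : Type*} [Field K] {a : K} {f g : RatFunc K} {u v : K}

theorem eval_eq (h : HasVal a f v) : RatFunc.eval (RingHom.id K) a f = v := by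
  obtain ⟨p, q, hq, hf, hv⟩ := h
  have hq0 : q ≠ 0 := by rintro rfl; simp at hq
  have hqa : algebraMap (Polynomial K) (RatFunc K) q ≠ 0 := by
    simpa using hq0
  have hd : f.denom ∣ q := by
    rw [RatFunc.denom_dvd hq0]
    exact ⟨p, by rw [← hf]; field_simp⟩
  have hda : f.denom.eval a ≠ 0 := by
    intro h0
    obtain ⟨r, rfl⟩ := hd
    simp [h0] at hq
  have hcross : f.num * q = p * f.denom := by
    apply RatFunc.algebraMap_injective K
    have hdd : algebraMap (Polynomial K) (RatFunc K) f.denom ≠ 0 := by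
      simpa using RatFunc.denom_ne_zero f
    have h1 : f = algebraMap _ _ f.num / algebraMap _ _ f.denom := (RatFunc.num_div_denom f).symm
    rw [eq_div_iff hdd] at h1
    rw [map_mul, map_mul, ← hf, ← h1]
    ring
  have h2 := congrArg (Polynomial.eval a) hcross
  simp only [Polynomial.eval_mul] at h2
  unfold RatFunc.eval
  simp only [Polynomial.eval₂_id]
  rw [div_eq_iff hda]
  apply mul_right_cancel₀ hq
  rw [h2, ← hv]; ring

theorem C (c : K) : HasVal a (RatFunc.C c) c :=
  ⟨Polynomial.C c, 1, by simp, by simp, by simp⟩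

theorem one : HasVal a (1 : RatFunc K) 1 := ⟨1, 1, by simp, by simp, by simp⟩

theorem zero : HasVal a (0 : RatFunc K) 0 := ⟨0, 1, by simp, by simp, by simp⟩

theorem X : HasVal a (RatFunc.X) a := ⟨Polynomial.X, 1, by simp, by simp, by simp⟩

theorem add (hf : HasVal a f u) (hg : HasVal a g v) : HasVal a (f + g) (u + v) := by
  obtain ⟨p, q, h1, h2, h3⟩ := hf
  obtain ⟨p', q', h1', h2', h3'⟩ := hg
  refine ⟨p * q' + p' * q, q * q', by simp [h1, h1'], ?_, ?_⟩
  · simp only [map_mul, map_add, ← h2, ← h2']; ring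
  · simp only [Polynomial.eval_mul, Polynomial.eval_add, ← h3, ← h3']; ring

theorem mul (hf : HasVal a f u) (hg : HasVal a g v) : HasVal a (f * g) (u * v) := by
  obtain ⟨p, q, h1, h2, h3⟩ := hf
  obtain ⟨p', q', h1', h2', h3'⟩ := hg
  refine ⟨p * p', q * q', by simp [h1, h1'], ?_, ?_⟩
  · simp only [map_mul, ← h2, ← h2']; ring
  · simp only [Polynomial.eval_mul, ← h3, ← h3']; ring

theorem neg (hf : HasVal a f u) : HasVal a (-f) (-u) := by
  obtain ⟨p, q, h1, h2, h3⟩ := hf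
  exact ⟨-p, q, h1, by simp [← h2], by simp [← h3]⟩

theorem sub (hf : HasVal a f u) (hg : HasVal a g v) : HasVal a (f - g) (u - v) := by
  rw [sub_eq_add_neg, sub_eq_add_neg]; exact hf.add hg.neg

theorem inv (hf : HasVal a f u) (hu : u ≠ 0) : HasVal a f⁻¹ u⁻¹ := by
  obtain ⟨p, q, h1, h2, h3⟩ := hf
  have hp : p.eval a ≠ 0 := by rw [← h3]; exact mul_ne_zero hu h1
  have hf0 : f ≠ 0 := by
    rintro rfl
    rw [zero_mul] at h2
    have : p = 0 := by
      apply RatFunc.algebraMap_injective K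
      rw [← h2, map_zero]
    simp [this] at hp
  refine ⟨q, p, hp, ?_, ?_⟩
  · rw [← h2]; field_simp
  · rw [← h3]; field_simp

theorem div (hf : HasVal a f u) (hg : HasVal a g v) (hv : v ≠ 0) : HasVal a (f / g) (u / v) := by
  rw [div_eq_mul_inv, div_eq_mul_inv]; exact hf.mul (hg.inv hv)

theorem sum {ι : Type*} (s : Finset ι) {f : ι → RatFunc K} {u : ι → K}
    (h : ∀ i ∈ s, HasVal a (f i) (u i)) : HasVal a (∑ i ∈ s, f i) (∑ i ∈ s, u i) := by
  classical
  induction s using Finset.induction_on with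
  | empty => simpa using zero
  | insert i s hi ih =>
    rw [Finset.sum_insert hi, Finset.sum_insert hi]
    exact (h i (by simp)).add (ih fun j hj => h j (by simp [hj]))

theorem prod {ι : Type*} (s : Finset ι) {f : ι → RatFunc K} {u : ι → K}
    (h : ∀ i ∈ s, HasVal a (f i) (u i)) : HasVal a (∏ i ∈ s, f i) (∏ i ∈ s, u i) := by
  classical
  induction s using Finset.induction_on with
  | empty => simpa using one
  | insert i s hi ih =>
    rw [Finset.prod_insert hi, Finset.prod_insert hi]
    exact (h i (by simp)).mul (ih fun j hj => h j (by simp [hj]))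

theorem pow (hf : HasVal a f u) (n : ℕ) : HasVal a (f ^ n) (u ^ n) := by
  induction n with
  | zero => simpa using one
  | succ n ih => rw [pow_succ, pow_succ]; exact ih.mul hf

theorem intCast (n : ℤ) : HasVal a (n : RatFunc K) (n : K) := by
  have := C (a := a) (n : K)
  rwa [map_intCast] at this

end HasVal

theorem filter_lt_eq_Ioi {n : ℕ} (i : Fin n) :
    Finset.univ.filter (fun j => i < j) = Finset.Ioi i := by
  ext; simp

/-- symmetric pair products are invariant under permutation -/
theorem pair_symm {R : Type*} [CommRing R] {n : ℕ} (f : Fin n → Fin n → R)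
    (hf : ∀ i j, f i j = f j i) (σ : Equiv.Perm (Fin n)) :
    ∏ i : Fin n, ∏ j ∈ Finset.univ.filter (fun j => i < j), f (σ i) (σ j) =
    ∏ i : Fin n, ∏ j ∈ Finset.univ.filter (fun j => i < j), f i j := by
  simp only [filter_lt_eq_Ioi]
  let h : Fin n → Fin n → R := fun i j => if i < j then 1 else if j < i then -1 else 0
  have hh : ∀ i j, h i j = - h j i := by
    intro i j
    rcases lt_trichotomy i j with h1 | h1 | h1
    · simp [h, h1, h1.not_gt]
    · simp [h, h1]
    · simp [h, h1, h1.not_gt]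
  have h1 := Equiv.Perm.prod_Ioi_comp_eq_sign_mul_prod σ (f := h) hh
  have h2 := Equiv.Perm.prod_Ioi_comp_eq_sign_mul_prod σ (f := fun i j => f i j * h i j)
    (fun i j => by rw [hf i j, hh i j]; ring)
  have h3 : ∏ i : Fin n, ∏ j ∈ Finset.Ioi i, h i j = 1 := by
    apply Finset.prod_eq_one; intro i _
    apply Finset.prod_eq_one; intro j hj
    simp [h, Finset.mem_Ioi.mp hj]
  simp only [Finset.prod_mul_distrib] at h2
  rw [h1, h3, mul_one, mul_one] at h2
  have hs : (((Equiv.Perm.sign σ : ℤˣ) : ℤ) : R) * (((Equiv.Perm.sign σ : ℤˣ) : ℤ) : R) = 1 := by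
    rcases Int.units_eq_one_or (Equiv.Perm.sign σ) with h | h <;> simp [h]
  calc _ = (∏ i : Fin n, ∏ j ∈ Finset.Ioi i, f (σ i) (σ j)) *
        (((Equiv.Perm.sign σ : ℤˣ) : ℤ) : R) * (((Equiv.Perm.sign σ : ℤˣ) : ℤ) : R) := by
          rw [mul_assoc, hs, mul_one]
    _ = _ := by rw [h2, mul_right_comm, hs, one_mul]

theorem Ftilde_perm {K : Type*} [Field K] (w : K) (n : ℕ) (x : Fin n → K)
    (τ : Equiv.Perm (Fin n)) : Ftilde w n (x ∘ τ) = Ftilde w n x := by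
  have hs : (((Equiv.Perm.sign τ : ℤˣ) : ℤ) : K) * (((Equiv.Perm.sign τ : ℤˣ) : ℤ) : K) = 1 := by
    rcases Int.units_eq_one_or (Equiv.Perm.sign τ) with h | h <;> simp [h]
  have hs0 : (((Equiv.Perm.sign τ : ℤˣ) : ℤ) : K) ≠ 0 := left_ne_zero_of_mul_eq_one hs
  unfold Ftilde
  congr 1
  · congr 1
    · exact Equiv.prod_comp τ (fun i => 1 - x i)
    · exact pair_symm (fun i j => 1 - x i * x j) (fun i j => by rw [mul_comm]) τ
  · unfold Ffun
    have hV : ∏ i : Fin n, ∏ j ∈ Finset.univ.filter (fun j => i < j), ((x ∘ τ) j - (x ∘ τ) i) =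
        (((Equiv.Perm.sign τ : ℤˣ) : ℤ) : K) *
        ∏ i : Fin n, ∏ j ∈ Finset.univ.filter (fun j => i < j), (x j - x i) := by
      simp only [filter_lt_eq_Ioi]
      exact Equiv.Perm.prod_Ioi_comp_eq_sign_mul_prod τ (f := fun i j => x j - x i)
        (fun i j => by ring)
    rw [hV]
    rw [← mul_div_mul_left _ (∏ i : Fin n, ∏ j ∈ Finset.univ.filter (fun j => i < j),
      (x j - x i)) hs0]
    congr 1
    rw [Finset.mul_sum]
    refine Fintype.sum_equiv (Equiv.mulLeft τ) _ _ fun σ => ?_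
    simp only [Equiv.coe_mulLeft, Equiv.Perm.sign_mul, Equiv.Perm.mul_apply, Function.comp_apply,
      Units.val_mul, Int.cast_mul]
    rw [mul_assoc (((Equiv.Perm.sign τ : ℤˣ) : ℤ) : K) _ (_ * _),
      ← mul_assoc (((Equiv.Perm.sign τ : ℤˣ) : ℤ) : K) (((Equiv.Perm.sign τ : ℤˣ) : ℤ) : K),
      hs, one_mul]

theorem pair_castSucc {R : Type*} [CommRing R] {n : ℕ} (f : Fin (n + 1) → Fin (n + 1) → R) :
    ∏ i : Fin (n + 1), ∏ j ∈ Finset.univ.filter (fun j => i < j), f i j =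
    (∏ i : Fin n, ∏ j ∈ Finset.univ.filter (fun j => i < j), f i.castSucc j.castSucc) *
      ∏ k : Fin n, f k.castSucc (Fin.last n) := by
  simp only [Finset.prod_filter, Fin.prod_univ_castSucc, Finset.prod_mul_distrib]
  simp [Fin.castSucc_lt_last, (Fin.castSucc_lt_last _).not_gt]

theorem tail_castSucc {R : Type*} [CommRing R] {n : ℕ} (g : Fin (n + 1) → R) (i : Fin n) :
    ∏ j ∈ Finset.univ.filter (fun j => i.castSucc ≤ j), g j =
    (∏ j ∈ Finset.univ.filter (fun j => i ≤ j), g j.castSucc) * g (Fin.last n) := by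
  simp only [Finset.prod_filter, Fin.prod_univ_castSucc]
  simp [Fin.le_last]

theorem tail_last {R : Type*} [CommRing R] {n : ℕ} (g : Fin (n + 1) → R) :
    ∏ j ∈ Finset.univ.filter (fun j => Fin.last n ≤ j), g j = g (Fin.last n) := by
  simp only [Finset.prod_filter, Fin.prod_univ_castSucc]
  simp

/-- extension of a pair of permutations -/
def ext2 {p : ℕ} (t : Equiv.Perm (Fin p) × Equiv.Perm (Fin 2)) : Equiv.Perm (Fin (p + 2)) :=
  (finSumFinEquiv (m := p) (n := 2)).permCongr (Equiv.Perm.sumCongrHom _ _ t)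

theorem ext2_injective {p : ℕ} : Function.Injective (ext2 (p := p)) :=
  (Equiv.injective _).comp Equiv.Perm.sumCongrHom_injective

theorem ext2_sign {p : ℕ} (t : Equiv.Perm (Fin p) × Equiv.Perm (Fin 2)) :
    Equiv.Perm.sign (ext2 t) = Equiv.Perm.sign t.1 * Equiv.Perm.sign t.2 := by
  unfold ext2
  rw [Equiv.Perm.sign_permCongr]
  exact Equiv.Perm.sign_sumCongr _ _

theorem ext2_castSucc {p : ℕ} (t : Equiv.Perm (Fin p) × Equiv.Perm (Fin 2)) (k : Fin p) :
    ext2 t k.castSucc.castSucc = (t.1 k).castSucc.castSucc := by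
  have : k.castSucc.castSucc = finSumFinEquiv (m := p) (n := 2) (Sum.inl k) := rfl
  unfold ext2
  rw [this, Equiv.permCongr_apply, Equiv.symm_apply_apply]
  rfl

theorem ext2_natAdd {p : ℕ} (t : Equiv.Perm (Fin p) × Equiv.Perm (Fin 2)) (k : Fin 2) :
    ext2 t (Fin.natAdd p k) = Fin.natAdd p (t.2 k) := by
  have : Fin.natAdd p k = finSumFinEquiv (m := p) (n := 2) (Sum.inr k) := rfl
  unfold ext2
  rw [this, Equiv.permCongr_apply, Equiv.symm_apply_apply]
  rfl

theorem mem_range_ext2 {p : ℕ} (σ : Equiv.Perm (Fin (p + 2)))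
    (h : ∀ k : Fin p, ∃ l : Fin p, σ k.castSucc.castSucc = l.castSucc.castSucc) :
    σ ∈ Set.range (ext2 (p := p)) := by
  have := Equiv.Perm.mem_sumCongrHom_range_of_perm_mapsTo_inl
    (σ := (finSumFinEquiv (m := p) (n := 2)).symm.permCongr σ) (by
      rintro _ ⟨k, rfl⟩
      obtain ⟨l, hl⟩ := h k
      refine ⟨l, ?_⟩
      rw [Equiv.permCongr_apply, Equiv.eq_symm_apply]
      exact hl.symm)
  obtain ⟨t, ht⟩ := this
  refine ⟨t, ?_⟩
  unfold ext2
  rw [ht]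
  ext; simp

theorem mem_range_ext2_of_image {p : ℕ} (σ : Equiv.Perm (Fin (p + 2))) (i : Fin (p + 2))
    (h : (Finset.univ.filter (fun j => i ≤ j)).map σ.toEmbedding =
      {(Fin.last p).castSucc, Fin.last (p + 1)}) :
    σ ∈ Set.range (ext2 (p := p)) := by
  have hc := congrArg Finset.card h
  have h1 : Finset.univ.filter (fun j => i ≤ j) = Finset.Ici i := by ext; simp
  rw [Finset.card_map, h1, Fin.card_Ici, Finset.card_pair (Fin.castSucc_lt_last _).ne] at hc
  apply mem_range_ext2
  intro k
  have hk : σ k.castSucc.castSucc ∉ (Finset.univ.filter (fun j => i ≤ j)).map σ.toEmbedding := by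
    rw [Finset.mem_map]
    rintro ⟨j, hj, hj2⟩
    have hjk : j = k.castSucc.castSucc := σ.injective hj2
    rw [hjk, Finset.mem_filter] at hj
    have h3 := Fin.le_def.mp hj.2
    simp only [Fin.val_castSucc] at h3
    omega
  rw [h] at hk
  simp only [Finset.mem_insert, Finset.mem_singleton, not_or] at hk
  obtain ⟨a, ha⟩ := Fin.exists_castSucc_eq.2 hk.2
  rw [← ha] at hk ⊢
  obtain ⟨b, hb⟩ := Fin.exists_castSucc_eq.2 (fun h => hk.1 (congrArg _ h))
  exact ⟨b, by rw [hb]⟩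

/-- the term with the second-to-last inverse factor removed -/
def Gterm {K : Type*} [Field K] (w : K) (p : ℕ) (v : Fin (p + 2) → K)
    (σ : Equiv.Perm (Fin (p + 2))) : K :=
  ((Equiv.Perm.sign σ : ℤ) : K) *
      ((∏ i : Fin (p + 2), ∏ j ∈ Finset.univ.filter (fun j => i < j),
          (v (σ i) * v (σ j) + 1 + w * v (σ i))) *
        ∏ i : Fin (p + 2), (v (σ i) ^ (i : ℕ) *
          if i = (Fin.last p).castSucc then 1 else
          (1 - ∏ j ∈ Finset.univ.filter (fun j => i ≤ j), v (σ j))⁻¹))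

theorem Gterm_ext2_one {K : Type*} [Field K] (w : K) (p : ℕ) (v : Fin (p + 2) → K)
    (z : Fin p → K) (y : K) (hy : y ≠ 0)
    (hv : v = Fin.snoc (Fin.snoc z y : Fin (p + 1) → K) y⁻¹) (τ : Equiv.Perm (Fin p))  :
    Gterm w p v (ext2 (τ, 1)) = (((Equiv.Perm.sign τ : ℤ) : K) *
      ((∏ i : Fin p, ∏ j ∈ Finset.univ.filter (fun j => i < j),
          (z (τ i) * z (τ j) + 1 + w * z (τ i))) *
        ∏ i : Fin p, (z (τ i) ^ (i : ℕ) *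
          (1 - ∏ j ∈ Finset.univ.filter (fun j => i ≤ j), z (τ j))⁻¹))) *
      ((∏ k, (z k * y + 1 + w * z k)) * (∏ k, (z k * y⁻¹ + 1 + w * z k)) *
       ((y * y⁻¹ + 1 + w * y) * (y ^ p * (y⁻¹ ^ (p + 1) * (1 - y⁻¹)⁻¹)))) := by
  have e1 : ext2 (τ, 1) (Fin.last p).castSucc = (Fin.last p).castSucc := ext2_natAdd (τ, 1) 0
  have e2 : ext2 (τ, 1) (Fin.last (p + 1)) = Fin.last (p + 1) := ext2_natAdd (τ, 1) 1
  have hne : ∀ k : Fin p, k.castSucc.castSucc ≠ (Fin.last p).castSucc := fun k h =>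
    (Fin.castSucc_lt_last k).ne (Fin.castSucc_injective _ h)
  unfold Gterm
  rw [ext2_sign, pair_castSucc, pair_castSucc, Fin.prod_univ_castSucc, Fin.prod_univ_castSucc,
    Fin.prod_univ_castSucc]
  simp only [tail_castSucc, tail_last, ext2_castSucc, e1, e2, hv, Fin.snoc_castSucc, Fin.snoc_last,
    hne, if_false, if_true, (Fin.castSucc_lt_last (Fin.last p)).ne', Fin.val_castSucc, Fin.val_last,
    mul_inv_cancel_right₀ hy]
  rw [Equiv.prod_comp τ (fun k => z k * y + 1 + w * z k),
    Equiv.prod_comp τ (fun k => z k * y⁻¹ + 1 + w * z k)]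
  simp only [Equiv.Perm.sign_one, mul_one]
  ring

theorem Gterm_ext2_swap {K : Type*} [Field K] (w : K) (p : ℕ) (v : Fin (p + 2) → K)
    (z : Fin p → K) (y : K) (hy : y ≠ 0)
    (hv : v = Fin.snoc (Fin.snoc z y : Fin (p + 1) → K) y⁻¹) (τ : Equiv.Perm (Fin p))  :
    Gterm w p v (ext2 (τ, Equiv.swap 0 1)) = (((Equiv.Perm.sign τ : ℤ) : K) *
      ((∏ i : Fin p, ∏ j ∈ Finset.univ.filter (fun j => i < j),
          (z (τ i) * z (τ j) + 1 + w * z (τ i))) *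
        ∏ i : Fin p, (z (τ i) ^ (i : ℕ) *
          (1 - ∏ j ∈ Finset.univ.filter (fun j => i ≤ j), z (τ j))⁻¹))) *
      ((∏ k, (z k * y + 1 + w * z k)) * (∏ k, (z k * y⁻¹ + 1 + w * z k)) *
       (-((y⁻¹ * y + 1 + w * y⁻¹) * (y⁻¹ ^ p * (y ^ (p + 1) * (1 - y)⁻¹))))) := by
  have e1 : ext2 (τ, Equiv.swap 0 1) (Fin.last p).castSucc = Fin.last (p + 1) :=
    ext2_natAdd (τ, Equiv.swap 0 1) 0
  have e2 : ext2 (τ, Equiv.swap 0 1) (Fin.last (p + 1)) = (Fin.last p).castSucc :=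
    ext2_natAdd (τ, Equiv.swap 0 1) 1
  have hne : ∀ k : Fin p, k.castSucc.castSucc ≠ (Fin.last p).castSucc := fun k h =>
    (Fin.castSucc_lt_last k).ne (Fin.castSucc_injective _ h)
  unfold Gterm
  rw [ext2_sign, pair_castSucc, pair_castSucc, Fin.prod_univ_castSucc, Fin.prod_univ_castSucc,
    Fin.prod_univ_castSucc]
  simp only [tail_castSucc, tail_last, ext2_castSucc, e1, e2, hv, Fin.snoc_castSucc, Fin.snoc_last,
    hne, if_false, if_true, (Fin.castSucc_lt_last (Fin.last p)).ne', Fin.val_castSucc, Fin.val_last,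
    inv_mul_cancel_right₀ hy]
  rw [Equiv.prod_comp τ (fun k => z k * y + 1 + w * z k),
    Equiv.prod_comp τ (fun k => z k * y⁻¹ + 1 + w * z k)]
  rw [Equiv.Perm.sign_swap (by decide)]
  push_cast
  ring

theorem main_val {K : Type*} [Field K] (w : K) (p : ℕ) (z : Fin p → K) (y : K) (hy : y ≠ 0)
    (v : Fin (p + 2) → K) (hv : v = Fin.snoc (Fin.snoc z y : Fin (p + 1) → K) y⁻¹)
    (hnon : ∀ S : Finset (Fin (p + 2)), S.Nonempty →
      S ≠ {(Fin.last p).castSucc, Fin.last (p + 1)} → ∏ k ∈ S, v k ≠ 1)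
    (x : Fin (p + 2) → RatFunc K)
    (hx : x = Fin.snoc (Fin.snoc (fun k => RatFunc.C (z k)) (RatFunc.C y) :
      Fin (p + 1) → RatFunc K) RatFunc.X) :
    HasVal y⁻¹ ((1 - RatFunc.C y * RatFunc.X) *
      (∑ σ : Equiv.Perm (Fin (p + 2)), ((Equiv.Perm.sign σ : ℤ) : RatFunc K) *
      ((∏ i : Fin (p + 2), ∏ j ∈ Finset.univ.filter (fun j => i < j),
          (x (σ i) * x (σ j) + 1 + RatFunc.C w * x (σ i))) *
        ∏ i : Fin (p + 2), (x (σ i) ^ (i : ℕ) *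
          (1 - ∏ j ∈ Finset.univ.filter (fun j => i ≤ j), x (σ j))⁻¹))))
    (∑ t : Equiv.Perm (Fin p) × Equiv.Perm (Fin 2), Gterm w p v (ext2 t)) := by
  classical
  have hxv : ∀ k, HasVal y⁻¹ (x k) (v k) := by
    intro k
    rw [hx, hv]
    refine Fin.lastCases ?_ (fun k => ?_) k
    · simpa using HasVal.X
    · refine Fin.lastCases ?_ (fun k => ?_) k
      · simpa using HasVal.C y
      · simpa using HasVal.C (z k)
  have hsum : ∑ t : Equiv.Perm (Fin p) × Equiv.Perm (Fin 2), Gterm w p v (ext2 t) =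
      ∑ σ, if σ ∈ Set.range (ext2 (p := p)) then Gterm w p v σ else 0 := by
    apply Fintype.sum_of_injective ext2 ext2_injective
    · intro σ hσ
      rw [if_neg hσ]
    · intro t
      rw [if_pos ⟨t, rfl⟩]
  have h0 : HasVal y⁻¹ (1 - RatFunc.C y * RatFunc.X) 0 := by
    have := (HasVal.one (a := y⁻¹)).sub ((HasVal.C (a := y⁻¹) y).mul HasVal.X)
    rwa [mul_inv_cancel₀ hy, sub_self] at this
  have hX0 : (1 - RatFunc.C y * RatFunc.X : RatFunc K) ≠ 0 := by
    intro h
    have h1 : algebraMap (Polynomial K) (RatFunc K) (1 - Polynomial.C y * Polynomial.X) = 0 := by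
      simpa using h
    rw [← map_zero (algebraMap (Polynomial K) (RatFunc K))] at h1
    have h2 := congrArg (Polynomial.eval 0) (RatFunc.algebraMap_injective K h1)
    simp at h2
  have hpair : ∀ σ : Equiv.Perm (Fin (p + 2)), HasVal y⁻¹
      (∏ i : Fin (p + 2), ∏ j ∈ Finset.univ.filter (fun j => i < j),
          (x (σ i) * x (σ j) + 1 + RatFunc.C w * x (σ i)))
      (∏ i : Fin (p + 2), ∏ j ∈ Finset.univ.filter (fun j => i < j),
          (v (σ i) * v (σ j) + 1 + w * v (σ i))) := fun σ =>
    HasVal.prod _ fun i _ => HasVal.prod _ fun j _ =>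
      (((hxv _).mul (hxv _)).add HasVal.one).add ((HasVal.C w).mul (hxv _))
  have hinv : ∀ (σ : Equiv.Perm (Fin (p + 2))) (i : Fin (p + 2)),
      (Finset.univ.filter (fun j => i ≤ j)).map σ.toEmbedding ≠
        {(Fin.last p).castSucc, Fin.last (p + 1)} →
      HasVal y⁻¹ (1 - ∏ j ∈ Finset.univ.filter (fun j => i ≤ j), x (σ j))⁻¹
        (1 - ∏ j ∈ Finset.univ.filter (fun j => i ≤ j), v (σ j))⁻¹ := by
    intro σ i hne
    apply HasVal.inv
    · exact HasVal.one.sub (HasVal.prod _ fun j _ => hxv _)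
    · have := hnon _ (by
        rw [Finset.map_nonempty]
        exact ⟨i, by simp⟩) hne
      rw [Finset.prod_map] at this
      rw [sub_ne_zero]
      exact this.symm
  rw [hsum, Finset.mul_sum]
  apply HasVal.sum
  intro σ _
  split_ifs with hσ
  · obtain ⟨t, rfl⟩ := hσ
    set σ := ext2 t with hσ
    have hmem : ∀ k : Fin 2, Fin.natAdd p k = (Fin.last p).castSucc ∨
        Fin.natAdd p k = Fin.last (p + 1) := by
      intro k
      fin_cases k
      · left; rfl
      · right; rfl
    have e1 : σ (Fin.last p).castSucc = Fin.natAdd p (t.2 0) := ext2_natAdd t 0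
    have e2 : σ (Fin.last (p + 1)) = Fin.natAdd p (t.2 1) := ext2_natAdd t 1
    have hprod : x (σ (Fin.last p).castSucc) * x (σ (Fin.last (p + 1))) =
        RatFunc.C y * RatFunc.X := by
      have hne : σ (Fin.last p).castSucc ≠ σ (Fin.last (p + 1)) := fun h =>
        (Fin.castSucc_lt_last (Fin.last p)).ne (σ.injective h)
      have m1 := hmem (t.2 0)
      have m2 := hmem (t.2 1)
      rw [← e1] at m1
      rw [← e2] at m2
      rcases m1 with m1 | m1 <;> rcases m2 with m2 | m2
      · exact absurd (m1.trans m2.symm) hne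
      · rw [m1, m2, hx]; simp
      · rw [m1, m2, hx]; simp [mul_comm]
      · exact absurd (m1.trans m2.symm) hne
    have key : (1 - RatFunc.C y * RatFunc.X) * (∏ i : Fin (p + 2), (x (σ i) ^ (i : ℕ) *
          (1 - ∏ j ∈ Finset.univ.filter (fun j => i ≤ j), x (σ j))⁻¹)) =
        ∏ i : Fin (p + 2), (x (σ i) ^ (i : ℕ) *
          if i = (Fin.last p).castSucc then 1 else
          (1 - ∏ j ∈ Finset.univ.filter (fun j => i ≤ j), x (σ j))⁻¹) := by
      have : (1 - RatFunc.C y * RatFunc.X : RatFunc K) = ∏ i : Fin (p + 2),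
          if i = (Fin.last p).castSucc then (1 - RatFunc.C y * RatFunc.X) else 1 := by
        rw [Finset.prod_ite_eq' Finset.univ]; simp
      conv_lhs => rw [this]
      rw [← Finset.prod_mul_distrib]
      apply Finset.prod_congr rfl
      intro i _
      split_ifs with hi
      · rw [hi, tail_castSucc, tail_last, hprod, mul_left_comm, mul_inv_cancel₀ hX0]
      · rw [one_mul]
    rw [mul_left_comm, mul_left_comm (1 - RatFunc.C y * RatFunc.X), key]
    unfold Gterm
    refine (HasVal.intCast _).mul ((hpair σ).mul (HasVal.prod _ fun i _ => ?_))
    refine ((hxv _).pow _).mul ?_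
    split_ifs with hi
    · exact HasVal.one
    · apply hinv
      intro h
      apply hi
      have hc := congrArg Finset.card h
      have h1 : Finset.univ.filter (fun j => i ≤ j) = Finset.Ici i := by ext; simp
      rw [Finset.card_map, h1, Fin.card_Ici, Finset.card_pair (Fin.castSucc_lt_last _).ne] at hc
      apply Fin.ext
      simp only [Fin.val_castSucc, Fin.val_last]
      omega
  · have := h0.mul (u := 0) ((HasVal.intCast ((Equiv.Perm.sign σ : ℤˣ) : ℤ)).mul ((hpair σ).mul
      (HasVal.prod Finset.univ fun i _ => ((hxv (σ i)).pow (i : ℕ)).mul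
        (hinv σ i fun h => hσ (mem_range_ext2_of_image σ i h)))))
    rwa [zero_mul] at this

theorem main_general {K : Type*} [Field K] (w : K) (p : ℕ) (z : Fin p → K) (y : K) (hy : y ≠ 0)
    (v : Fin (p + 2) → K) (hv : v = Fin.snoc (Fin.snoc z y : Fin (p + 1) → K) y⁻¹)
    (hinj : Function.Injective v)
    (hnon : ∀ S : Finset (Fin (p + 2)), S.Nonempty →
      S ≠ {(Fin.last p).castSucc, Fin.last (p + 1)} → ∏ k ∈ S, v k ≠ 1)
    (x : Fin (p + 2) → RatFunc K)
    (hx : x = Fin.snoc (Fin.snoc (fun k => RatFunc.C (z k)) (RatFunc.C y) :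
      Fin (p + 1) → RatFunc K) RatFunc.X) :
    HasVal y⁻¹ (Ftilde (RatFunc.C w) (p + 2) x)
      ((w + 2) / y ^ p * (∏ k, ((1 + w * z k + z k * y) * (z k + y + w * z k * y))) *
        Ftilde w p z) := by
  classical
  have hxv : ∀ k, HasVal y⁻¹ (x k) (v k) := by
    intro k
    rw [hx, hv]
    refine Fin.lastCases ?_ (fun k => ?_) k
    · simpa using HasVal.X
    · refine Fin.lastCases ?_ (fun k => ?_) k
      · simpa using HasVal.C y
      · simpa using HasVal.C (z k)
  have hmain := main_val w p z y hy v hv hnon x hx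
  have vz : ∀ k : Fin p, v k.castSucc.castSucc = z k := fun k => by simp [hv]
  have vy : v (Fin.last p).castSucc = y := by simp [hv]
  have vyi : v (Fin.last (p + 1)) = y⁻¹ := by simp [hv]
  have hV0 : ∏ i : Fin (p + 2), ∏ j ∈ Finset.univ.filter (fun j => i < j), (v j - v i) ≠ 0 := by
    rw [Finset.prod_ne_zero_iff]; intro i _
    rw [Finset.prod_ne_zero_iff]; intro j hj
    rw [sub_ne_zero]
    intro h
    have := hinj h
    simp [this] at hj
  have hV : HasVal y⁻¹ (∏ i : Fin (p + 2), ∏ j ∈ Finset.univ.filter (fun j => i < j), (x j - x i))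
      (∏ i : Fin (p + 2), ∏ j ∈ Finset.univ.filter (fun j => i < j), (v j - v i)) :=
    HasVal.prod _ fun i _ => HasVal.prod _ fun j _ => (hxv j).sub (hxv i)
  have hP1 : HasVal y⁻¹ (∏ i : Fin (p + 2), (1 - x i)) (∏ i : Fin (p + 2), (1 - v i)) :=
    HasVal.prod _ fun i _ => HasVal.one.sub (hxv i)
  have hP2 : HasVal y⁻¹ ((∏ i : Fin p, ∏ j ∈ Finset.univ.filter (fun j => i < j),
      (1 - x i.castSucc.castSucc * x j.castSucc.castSucc)) *
      (∏ k : Fin p, (1 - x k.castSucc.castSucc * x (Fin.last p).castSucc)) *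
      (∏ k : Fin p, (1 - x k.castSucc.castSucc * x (Fin.last (p + 1)))))
      ((∏ i : Fin p, ∏ j ∈ Finset.univ.filter (fun j => i < j),
      (1 - v i.castSucc.castSucc * v j.castSucc.castSucc)) *
      (∏ k : Fin p, (1 - v k.castSucc.castSucc * v (Fin.last p).castSucc)) *
      (∏ k : Fin p, (1 - v k.castSucc.castSucc * v (Fin.last (p + 1))))) := by
    refine HasVal.mul (HasVal.mul ?_ ?_) ?_
    · exact HasVal.prod _ fun i _ => HasVal.prod _ fun j _ =>
        HasVal.one.sub ((hxv _).mul (hxv _))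
    · exact HasVal.prod _ fun i _ => HasVal.one.sub ((hxv _).mul (hxv _))
    · exact HasVal.prod _ fun i _ => HasVal.one.sub ((hxv _).mul (hxv _))
  have htot := ((hP1.mul hP2).mul hmain).div hV hV0
  have hx1 : x (Fin.last p).castSucc * x (Fin.last (p + 1)) = RatFunc.C y * RatFunc.X := by
    simp [hx]
  convert htot using 1
  · unfold Ftilde Ffun
    rw [pair_castSucc (fun i j => 1 - x i * x j),
      pair_castSucc (fun i j => 1 - x (Fin.castSucc i) * x (Fin.castSucc j)),
      Fin.prod_univ_castSucc (fun k => 1 - x (Fin.castSucc k) * x (Fin.last (p + 1))), hx1]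
    ring
  · have hpm : (Finset.univ : Finset (Equiv.Perm (Fin 2))) = {1, Equiv.swap 0 1} := by decide
    have h1s : (1 : Equiv.Perm (Fin 2)) ∉ ({Equiv.swap 0 1} : Finset (Equiv.Perm (Fin 2))) := by
      decide
    have hvy1 : y ≠ 1 := by
      have := hnon {(Fin.last p).castSucc} (by simp) (by
        intro h
        have := congrArg Finset.card h
        rw [Finset.card_singleton, Finset.card_pair (Fin.castSucc_lt_last _).ne] at this
        omega)
      simpa [vy] using this
    have hyy : y⁻¹ - y ≠ 0 := by
      rw [sub_ne_zero]
      intro h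
      exact (Fin.castSucc_lt_last (Fin.last p)).ne' (hinj (by rw [vyi, vy]; exact h))
    have hz1 : ∏ k, (y - z k) ≠ 0 := by
      rw [Finset.prod_ne_zero_iff]; intro k _
      rw [sub_ne_zero, ← vz, ← vy]
      intro h
      exact (Fin.castSucc_lt_last k).ne' (Fin.castSucc_injective _ (hinj h))
    have hz2 : ∏ k, (y⁻¹ - z k) ≠ 0 := by
      rw [Finset.prod_ne_zero_iff]; intro k _
      rw [sub_ne_zero, ← vz, ← vyi]
      intro h
      exact (Fin.castSucc_lt_last k.castSucc).ne' (hinj h)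
    rw [Fintype.sum_prod_type]
    simp only [hpm, Finset.sum_insert h1s, Finset.sum_singleton]
    simp only [Gterm_ext2_one w p v z y hy hv, Gterm_ext2_swap w p v z y hy hv, ← mul_add]
    rw [← Finset.sum_mul]
    rw [pair_castSucc, pair_castSucc] at hV0
    rw [pair_castSucc (fun i j => v j - v i), pair_castSucc, Fin.prod_univ_castSucc,
      Fin.prod_univ_castSucc, Fin.prod_univ_castSucc]
    rw [Fin.prod_univ_castSucc (fun k => v (Fin.last (p + 1)) - v (Fin.castSucc k))] at hV0
    simp only [vz, vy, vyi] at hV0 ⊢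
    unfold Ftilde Ffun
    set A := ∑ σ : Equiv.Perm (Fin p), ((Equiv.Perm.sign σ : ℤ) : K) *
      ((∏ i : Fin p, ∏ j ∈ Finset.univ.filter (fun j => i < j),
          (z (σ i) * z (σ j) + 1 + w * z (σ i))) *
        ∏ i : Fin p, (z (σ i) ^ (i : ℕ) *
          (1 - ∏ j ∈ Finset.univ.filter (fun j => i ≤ j), z (σ j))⁻¹)) with hA
    have q1 : ∏ k, (1 - z k * y) = y ^ p * ∏ k, (y⁻¹ - z k) := by
      rw [← Fin.prod_const, ← Finset.prod_mul_distrib]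
      exact Finset.prod_congr rfl fun k _ => by field_simp
    have q2 : ∏ k, (1 - z k * y⁻¹) = y⁻¹ ^ p * ∏ k, (y - z k) := by
      rw [← Fin.prod_const, ← Finset.prod_mul_distrib]
      exact Finset.prod_congr rfl fun k _ => by field_simp
    have q3 : ∏ k, (z k * y⁻¹ + 1 + w * z k) = y⁻¹ ^ p * ∏ k, (z k + y + w * z k * y) := by
      rw [← Fin.prod_const, ← Finset.prod_mul_distrib]
      exact Finset.prod_congr rfl fun k _ => by field_simp
    have q4 : ∏ k, (z k * y + 1 + w * z k) = ∏ k, (1 + w * z k + z k * y) :=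
      Finset.prod_congr rfl fun k _ => by ring
    rw [q1, q2, q3, q4, Finset.prod_mul_distrib]
    have hV1 := left_ne_zero_of_mul (left_ne_zero_of_mul hV0)
    have q5 : (y * y⁻¹ + 1 + w * y) * (y ^ p * (y⁻¹ ^ (p + 1) * (1 - y⁻¹)⁻¹)) +
        -((y⁻¹ * y + 1 + w * y⁻¹) * (y⁻¹ ^ p * (y ^ (p + 1) * (1 - y)⁻¹))) =
        (w + 2) * (y⁻¹ - y) * ((1 - y) * (1 - y⁻¹))⁻¹ := by
      have a1 : y ^ p * (y⁻¹ ^ (p + 1) * (1 - y⁻¹)⁻¹) = (y - 1)⁻¹ := by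
        have : (1 - y⁻¹) ≠ 0 := by
          rw [sub_ne_zero]; intro h; exact hvy1 (by rw [← inv_inv y, ← h, inv_one])
        rw [inv_pow, pow_succ]
        have h2 : y - 1 ≠ 0 := sub_ne_zero.2 hvy1
        have : y - 1 = y * (1 - y⁻¹) := by field_simp
        rw [this]
        field_simp
      have a2 : y⁻¹ ^ p * (y ^ (p + 1) * (1 - y)⁻¹) = -(y * (y - 1)⁻¹) := by
        rw [inv_pow, pow_succ, ← neg_sub y 1, inv_neg]
        field_simp
      have a3 : (1 - y) * (1 - y⁻¹) = - ((y - 1) ^ 2 * y⁻¹) := by field_simp; ring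
      rw [a1, a2, a3]
      have h2 : y - 1 ≠ 0 := sub_ne_zero.2 hvy1
      field_simp
      ring
    rw [q5]
    have hy1 : (1 - y) ≠ 0 := sub_ne_zero.2 hvy1.symm
    have hy2 : (1 - y⁻¹) ≠ 0 := by
      rw [sub_ne_zero]; intro h; exact hvy1 (by rw [← inv_inv y, ← h, inv_one])
    generalize (∏ k, (1 + w * z k + z k * y)) = B4
    generalize (∏ k, (z k + y + w * z k * y)) = B5
    generalize (∏ k, (y - z k)) = B1 at *
    generalize (∏ k, (y⁻¹ - z k)) = B2 at *
    generalize (∏ i : Fin p, ∏ j ∈ Finset.univ.filter (fun j => i < j), (z j - z i)) = B3 at *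
    generalize (y⁻¹ - y) = d at *
    generalize (1 - y⁻¹) = e1 at *
    generalize (1 - y) = e2 at *
    have hyp : y ^ p ≠ 0 := pow_ne_zero _ hy
    rw [inv_pow]
    generalize y ^ p = yp at *
    clear hV0
    field_simp

theorem xx_prod {m : ℕ} (f : Fin m → ℕ) (S : Finset (Fin m)) :
    ∏ k ∈ S, xx (f k) =
      algebraMap (MvPolynomial ℕ ℚ) KK (∏ k ∈ S, MvPolynomial.X (f k)) := by
  rw [map_prod]; rfl

theorem alg_ne {P Q : MvPolynomial ℕ ℚ} (c : ℕ → ℚ)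
    (h : MvPolynomial.eval c P ≠ MvPolynomial.eval c Q) :
    algebraMap (MvPolynomial ℕ ℚ) KK P ≠ algebraMap (MvPolynomial ℕ ℚ) KK Q := by
  intro h1
  exact h (congrArg _ (IsFractionRing.injective (MvPolynomial ℕ ℚ) KK h1))

theorem xx_prod_ne_one {m : ℕ} (f : Fin m → ℕ) (S : Finset (Fin m)) (hS : S.Nonempty) :
    ∏ k ∈ S, xx (f k) ≠ 1 := by
  rw [xx_prod, ← map_one (algebraMap (MvPolynomial ℕ ℚ) KK)]
  apply alg_ne (fun _ => 0)
  obtain ⟨k, hk⟩ := hS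
  rw [map_prod, Finset.prod_eq_zero hk (by simp)]
  simp

theorem xx_prod_mul_ne_one {m : ℕ} (f : Fin m → ℕ) (S : Finset (Fin m)) (a : ℕ) :
    (∏ k ∈ S, xx (f k)) * xx a ≠ 1 := by
  rw [xx_prod, ← map_one (algebraMap (MvPolynomial ℕ ℚ) KK), xx, ← map_mul]
  apply alg_ne (fun _ => 0)
  simp

theorem xx_prod_ne {m : ℕ} (f : Fin m → ℕ) (S : Finset (Fin m)) (a : ℕ) (ha : ∀ k, f k ≠ a) :
    (∏ k ∈ S, xx (f k)) ≠ xx a := by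
  rw [xx_prod, xx]
  apply alg_ne (fun b => if b = a then 0 else 1)
  simp [ha]

theorem xx_ne_zero (a : ℕ) : xx a ≠ 0 := by
  rw [xx, ← map_zero (algebraMap (MvPolynomial ℕ ℚ) KK)]
  apply alg_ne (fun _ => 1)
  simp

theorem xx_injective : Function.Injective xx := by
  intro a b h
  exact MvPolynomial.X_injective (IsFractionRing.injective (MvPolynomial ℕ ℚ) KK h)

theorem hnon_xx {p : ℕ} (f : Fin p → ℕ) (a : ℕ) (ha : ∀ k, f k ≠ a)
    (v : Fin (p + 2) → KK)
    (hv : v = Fin.snoc (Fin.snoc (fun k => xx (f k)) (xx a) : Fin (p + 1) → KK) (xx a)⁻¹)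
    (S : Finset (Fin (p + 2))) (hS : S.Nonempty)
    (hS2 : S ≠ {(Fin.last p).castSucc, Fin.last (p + 1)}) : ∏ k ∈ S, v k ≠ 1 := by
  classical
  have h0 := xx_ne_zero a
  have key : ∏ k ∈ S, v k =
      (∏ k ∈ Finset.univ.filter (fun k : Fin p => k.castSucc.castSucc ∈ S), xx (f k)) *
      (if (Fin.last p).castSucc ∈ S then xx a else 1) *
      (if Fin.last (p + 1) ∈ S then (xx a)⁻¹ else 1) := by
    have : ∏ k ∈ S, v k = ∏ k, if k ∈ S then v k else 1 := by simp
    rw [this, Fin.prod_univ_castSucc, Fin.prod_univ_castSucc, Finset.prod_filter]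
    simp [hv]
  rw [key]
  split_ifs with h1 h2 h2
  · rw [mul_inv_cancel_right₀ h0]
    apply xx_prod_ne_one
    by_contra hne
    apply hS2
    rw [Finset.not_nonempty_iff_eq_empty, Finset.filter_eq_empty_iff] at hne
    ext k
    refine Fin.lastCases ?_ (fun k => ?_) k
    · simp [h2]
    · refine Fin.lastCases ?_ (fun k => ?_) k
      · simp [h1]
      · have h3 := hne (Finset.mem_univ k)
        have h4 : k.castSucc.castSucc ≠ (Fin.last p).castSucc := fun h =>
          (Fin.castSucc_lt_last k).ne (Fin.castSucc_injective _ h)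
        have h5 := (Fin.castSucc_lt_last k.castSucc).ne
        simp [h3, h4, h5]
  · rw [mul_one]; exact xx_prod_mul_ne_one _ _ _
  · rw [mul_one, ← div_eq_mul_inv, Ne, div_eq_one_iff_eq h0]
    exact xx_prod_ne _ _ _ ha
  · rw [mul_one, mul_one]
    apply xx_prod_ne_one
    obtain ⟨k, hk⟩ := hS
    revert hk
    refine Fin.lastCases (fun hk => absurd hk h2) (fun k => ?_) k
    refine Fin.lastCases (fun hk => absurd hk h1) (fun k hk => ?_) k
    exact ⟨k, by simpa using hk⟩

theorem hinj_xx {p : ℕ} (f : Fin p → ℕ) (hf : Function.Injective f) (a : ℕ) (ha : ∀ k, f k ≠ a)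
    (v : Fin (p + 2) → KK)
    (hv : v = Fin.snoc (Fin.snoc (fun k => xx (f k)) (xx a) : Fin (p + 1) → KK) (xx a)⁻¹) :
    Function.Injective v := by
  have h0 := xx_ne_zero a
  have hb : ∀ b, xx b ≠ (xx a)⁻¹ := by
    intro b h
    have := xx_prod_mul_ne_one (m := 1) (fun _ => b) Finset.univ a
    apply this
    simp [h, h0]
  rw [hv]
  rw [Fin.snoc_injective_iff, Fin.snoc_injective_iff]
  refine ⟨⟨xx_injective.comp hf, ?_⟩, ?_⟩
  · rintro ⟨k, hk⟩
    exact ha k (xx_injective hk)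
  · rintro ⟨k, hk⟩
    revert hk
    refine Fin.lastCases ?_ (fun k => ?_) k
    · simpa using hb a
    · simpa using hb (f k)

/-- extension of a permutation fixing the last place -/
def extLast {n : ℕ} (π : Equiv.Perm (Fin n)) : Equiv.Perm (Fin (n + 1)) :=
  (finSuccEquiv' (Fin.last n)).trans
    ((Equiv.optionCongr π).trans (finSuccEquiv' (Fin.last n)).symm)

theorem extLast_last {n : ℕ} (π : Equiv.Perm (Fin n)) : extLast π (Fin.last n) = Fin.last n := by
  simp [extLast]

theorem extLast_castSucc {n : ℕ} (π : Equiv.Perm (Fin n)) (k : Fin n) :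
    extLast π k.castSucc = (π k).castSucc := by
  have : finSuccEquiv' (Fin.last n) k.castSucc = some k := finSuccEquiv'_last_apply_castSucc k
  simp only [extLast, Equiv.trans_apply, this]
  simp

/-- permutation moving `i` to the last place -/
def moveLast {p : ℕ} (i : Fin (p + 1)) : Equiv.Perm (Fin (p + 1)) :=
  (finSuccEquiv' (Fin.last p)).trans (finSuccEquiv' i).symm

theorem moveLast_last {p : ℕ} (i : Fin (p + 1)) : moveLast i (Fin.last p) = i := by
  simp [moveLast]

theorem moveLast_castSucc {p : ℕ} (i : Fin (p + 1)) (k : Fin p) :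
    moveLast i k.castSucc = i.succAbove k := by
  have : finSuccEquiv' (Fin.last p) k.castSucc = some k := finSuccEquiv'_last_apply_castSucc k
  simp only [moveLast, Equiv.trans_apply, this]
  simp

/-- permutation moving `i` to the second-to-last place -/
def movePerm {p : ℕ} (i : Fin (p + 1)) : Equiv.Perm (Fin (p + 2)) := extLast (moveLast i)

theorem movePerm_comp {K : Type*} {p : ℕ} (i : Fin (p + 1)) (g : Fin (p + 1) → K) (t : K) :
    (Fin.snoc g t : Fin (p + 2) → K) ∘ movePerm i =
      (Fin.snoc (Fin.snoc (fun k => g (i.succAbove k)) (g i) : Fin (p + 1) → K) t :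
        Fin (p + 2) → K) := by
  funext k
  refine Fin.lastCases ?_ (fun k => ?_) k
  · simp [movePerm, extLast_last, extLast_castSucc, moveLast_last, moveLast_castSucc]
  · refine Fin.lastCases ?_ (fun k => ?_) k
    · simp [movePerm, extLast_last, extLast_castSucc, moveLast_last, moveLast_castSucc]
    · simp [movePerm, extLast_last, extLast_castSucc, moveLast_last, moveLast_castSucc]

/-- For `n = p+2 > 1` and `1 ≤ i ≤ n-1` (here `i : Fin (p+1)`):
`F̃(x_1,…,x_n)|_{x_n = x_i⁻¹}
  = ((w+2)/x_i^{n-2}) ∏_{k≠i, 1≤k≤n-1} (1 + w x_k + x_k x_i)(x_k + x_i + w x_k x_i)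
    · F̃(x_1,…,x̂_i,…,x_{n-1})`.
The left-hand side is computed by regarding `F̃(x_1,…,x_{n-1}, T)` as a univariate
rational function in `T = RatFunc.X` over `ℚ(w,x_1,…,x_{n-1})` and evaluating it at
`T = x_i⁻¹`; since `F̃` is regular there, `RatFunc.eval` returns the genuine value. -/
theorem stmt16 (p : ℕ) (i : Fin (p + 1)) :
    RatFunc.eval (RingHom.id KK) ((xx ((i : ℕ) + 1))⁻¹)
      (Ftilde (RatFunc.C ww) (p + 2)
        (Fin.snoc (fun k : Fin (p + 1) => RatFunc.C (xx ((k : ℕ) + 1))) RatFunc.X))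
    = ((ww + 2) / (xx ((i : ℕ) + 1)) ^ p) *
        (∏ k ∈ Finset.univ.erase i,
          ((1 + ww * xx ((k : ℕ) + 1) + xx ((k : ℕ) + 1) * xx ((i : ℕ) + 1)) *
            (xx ((k : ℕ) + 1) + xx ((i : ℕ) + 1) +
              ww * xx ((k : ℕ) + 1) * xx ((i : ℕ) + 1)))) *
        Ftilde ww p ((fun k : Fin (p + 1) => xx ((k : ℕ) + 1)) ∘ i.succAbove) := by
  have h := main_general ww p (fun k => xx ((i.succAbove k : ℕ) + 1)) (xx ((i : ℕ) + 1))
    (xx_ne_zero _) _ rfl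
    (hinj_xx (fun k => (i.succAbove k : ℕ) + 1) (fun k l hkl => by
      apply Fin.succAbove_right_injective (p := i)
      apply Fin.ext
      simpa using hkl) _ (fun k hk => Fin.succAbove_ne i k (Fin.ext (by simpa using hk))) _ rfl)
    (hnon_xx (fun k => (i.succAbove k : ℕ) + 1) _
      (fun k hk => Fin.succAbove_ne i k (Fin.ext (by simpa using hk))) _ rfl) _ rfl
  rw [← Ftilde_perm _ _ _ (movePerm i), movePerm_comp, h.eval_eq]
  have herase : Finset.univ.erase i = Finset.univ.map i.succAboveEmb := by
    ext k
    simp [Fin.exists_succAbove_eq_iff]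
  rw [herase, Finset.prod_map]
  rfl

end
end

section
/- (Main Littlewood-type identity for modified Robbins polynomials) For every positive integer n, ∑_{0 ≤ k_1 < ... < k_n} R*_{(k_1,...,k_n)}(x_1,...,x_n; 1,1,w) = ∏_{i=1}^{n} 1/(1-x_i) · ∏_{1≤i<j≤n} (x_i + x_j + w x_i x_j)/(x_j - x_i) · pf_{χ_even(n) ≤ i < j ≤ n}(a_{ij}), where a_{0j} = 1 and a_{ij} = ((x_j - x_i)(1 + (1+w) x_i x_j))/((x_i + x_j + w x_i x_j)(1 - x_i x_j)) for i ≥ 1, and χ_even(n) = 1 if n is even, 0 otherwise. -/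
noncomputable section

section Pf

variable {K : Type*} [Field K]

/-- Insert a first value `k` into a permutation. -/
def permJ {n : ℕ} (k : Fin (n + 1)) (τ : Equiv.Perm (Fin n)) : Equiv.Perm (Fin (n + 1)) :=
  k.cycleRange.symm * Equiv.Perm.decomposeFin.symm (0, τ)

lemma permJ_zero {n : ℕ} (k : Fin (n + 1)) (τ : Equiv.Perm (Fin n)) : permJ k τ 0 = k := by
  simp [permJ]

lemma permJ_succ {n : ℕ} (k : Fin (n + 1)) (τ : Equiv.Perm (Fin n)) (i : Fin n) :
    permJ k τ i.succ = k.succAbove (τ i) := by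
  simp [permJ]

lemma permJ_sign {n : ℕ} (k : Fin (n + 1)) (τ : Equiv.Perm (Fin n)) :
    ((Equiv.Perm.sign (permJ k τ) : ℤ) : K) = (-1) ^ (k : ℕ) * ((Equiv.Perm.sign τ : ℤ) : K) := by
  simp [permJ, Equiv.Perm.decomposeFin.symm_sign, Fin.sign_cycleRange]

lemma permJ_bij {n : ℕ} :
    Function.Bijective (fun p : Fin (n + 1) × Equiv.Perm (Fin n) => permJ p.1 p.2) := by
  rw [Fintype.bijective_iff_injective_and_card]
  constructor
  · rintro ⟨k, τ⟩ ⟨k', τ'⟩ h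
    simp only at h
    have h0 : k = k' := by
      rw [← permJ_zero k τ, h, permJ_zero]
    subst h0
    congr 1
    ext i : 1
    have := congrArg (fun e => e i.succ) h
    simp only [permJ_succ] at this
    exact Fin.succAbove_right_injective this
  · simp [Fintype.card_perm, Nat.factorial_succ]

lemma sum_perm_succ_s17 {n : ℕ} (G : Equiv.Perm (Fin (n + 1)) → K) :
    ∑ σ, G σ = ∑ k, ∑ τ, G (permJ k τ) := by
  rw [← Fintype.sum_prod_type', ← (permJ_bij (n := n)).sum_comp G]

def eP {m : ℕ} (i : Fin m) : Fin (2 * m) := ⟨2 * i.val, by omega⟩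
def oP {m : ℕ} (i : Fin m) : Fin (2 * m) := ⟨2 * i.val + 1, by omega⟩

def pfTerm {m : ℕ} (A : Fin (2 * m) → Fin (2 * m) → K) (σ : Equiv.Perm (Fin (2 * m))) : K :=
  ((Equiv.Perm.sign σ : ℤ) : K) * ∏ i : Fin m, A (σ (eP i)) (σ (oP i))

def pfT {m : ℕ} (A : Fin (2 * m) → Fin (2 * m) → K) : K := ∑ σ, pfTerm A σ

lemma pfaffian_eq_pfT {m : ℕ} (A : Fin (2 * m) → Fin (2 * m) → K) :
    pfaffian A = pfT A / ((2 ^ m * Nat.factorial m : ℕ) : K) := rfl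

lemma eP_inj {m : ℕ} (i j : Fin m) : eP i = eP j ↔ i = j := by
  simp [eP, Fin.ext_iff]
lemma oP_inj {m : ℕ} (i j : Fin m) : oP i = oP j ↔ i = j := by
  simp [oP, Fin.ext_iff]
lemma eP_ne_oP {m : ℕ} (i j : Fin m) : eP i ≠ oP j := by
  simp only [eP, oP, ne_eq, Fin.ext_iff]; omega
lemma oP_ne_eP {m : ℕ} (i j : Fin m) : oP i ≠ eP j := (eP_ne_oP j i).symm

lemma eP_or_oP {m : ℕ} (t : Fin (2 * m)) : (∃ i, t = eP i) ∨ (∃ i, t = oP i) := by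
  rcases Nat.even_or_odd' t.val with ⟨c, h | h⟩
  · exact Or.inl ⟨⟨c, by omega⟩, Fin.ext h⟩
  · exact Or.inr ⟨⟨c, by omega⟩, Fin.ext h⟩

/-- swap the pairs `a` and `b`. -/
def pairSwap {m : ℕ} (a b : Fin m) : Equiv.Perm (Fin (2 * m)) :=
  Equiv.swap (eP a) (eP b) * Equiv.swap (oP a) (oP b)

lemma pairSwap_eP {m : ℕ} (a b i : Fin m) : pairSwap a b (eP i) = eP (Equiv.swap a b i) := by
  simp only [pairSwap, Equiv.Perm.mul_apply]
  rw [Equiv.swap_apply_of_ne_of_ne (eP_ne_oP _ _) (eP_ne_oP _ _)]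
  simp only [Equiv.swap_apply_def, eP_inj]
  split_ifs <;> rfl

lemma pairSwap_oP {m : ℕ} (a b i : Fin m) : pairSwap a b (oP i) = oP (Equiv.swap a b i) := by
  simp only [pairSwap, Equiv.Perm.mul_apply]
  have : Equiv.swap (oP a) (oP b) (oP i) = oP (Equiv.swap a b i) := by
    simp only [Equiv.swap_apply_def, oP_inj]
    split_ifs <;> rfl
  rw [this, Equiv.swap_apply_of_ne_of_ne (oP_ne_eP _ _) (oP_ne_eP _ _)]

lemma pairSwap_sign {m : ℕ} (a b : Fin m) : Equiv.Perm.sign (pairSwap a b) = 1 := by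
  simp only [pairSwap, Equiv.Perm.sign_mul, Equiv.Perm.sign_swap', eP_inj, oP_inj]
  split_ifs <;> simp

lemma pfTerm_pairSwap {m : ℕ} (A : Fin (2 * m) → Fin (2 * m) → K) (σ : Equiv.Perm (Fin (2 * m)))
    (a b : Fin m) : pfTerm A (σ * pairSwap a b) = pfTerm A σ := by
  simp only [pfTerm, Equiv.Perm.sign_mul, pairSwap_sign, mul_one, Equiv.Perm.mul_apply,
    pairSwap_eP, pairSwap_oP]
  congr 1
  exact Equiv.prod_comp (Equiv.swap a b) (fun i => A (σ (eP i)) (σ (oP i)))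

lemma pfTerm_flip {m : ℕ} (A : Fin (2 * m) → Fin (2 * m) → K) (hA : ∀ i j, A j i = - A i j)
    (σ : Equiv.Perm (Fin (2 * m))) (a : Fin m) :
    pfTerm A (σ * Equiv.swap (eP a) (oP a)) = pfTerm A σ := by
  simp only [pfTerm, Equiv.Perm.sign_mul, Equiv.Perm.sign_swap (eP_ne_oP a a),
    Equiv.Perm.mul_apply]
  rw [← Finset.mul_prod_erase _ _ (Finset.mem_univ a),
    ← Finset.mul_prod_erase (a := a) _ (fun i => A (σ (eP i)) (σ (oP i))) (Finset.mem_univ a)]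
  have : ∀ i ∈ Finset.univ.erase a,
      A (σ (Equiv.swap (eP a) (oP a) (eP i))) (σ (Equiv.swap (eP a) (oP a) (oP i)))
      = A (σ (eP i)) (σ (oP i)) := by
    intro i hi
    have hi := Finset.ne_of_mem_erase hi
    rw [Equiv.swap_apply_of_ne_of_ne (by simpa [eP_inj] using hi) (eP_ne_oP _ _),
      Equiv.swap_apply_of_ne_of_ne (oP_ne_eP _ _) (by simpa [oP_inj] using hi)]
  rw [Finset.prod_congr rfl this]
  simp only [Equiv.swap_apply_left, Equiv.swap_apply_right, hA (σ (eP a)) (σ (oP a))]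
  push_cast
  ring

lemma pfT_fixed {m : ℕ} (A : Fin (2 * (m + 1)) → Fin (2 * (m + 1)) → K)
    (hA : ∀ i j, A j i = - A i j) (t : Fin (2 * (m + 1))) :
    ∑ σ : Equiv.Perm (Fin (2 * (m + 1))), (if σ t = eP 0 then pfTerm A σ else 0)
      = ∑ σ : Equiv.Perm (Fin (2 * (m + 1))), (if σ (eP 0) = eP 0 then pfTerm A σ else 0) := by
  obtain ⟨π, h0, hπ⟩ : ∃ π : Equiv.Perm (Fin (2 * (m + 1))), π (eP 0) = t ∧
      ∀ σ, pfTerm A (σ * π) = pfTerm A σ := by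
    rcases eP_or_oP t with ⟨i, rfl⟩ | ⟨i, rfl⟩
    · exact ⟨pairSwap 0 i, by simp [pairSwap_eP], fun σ => pfTerm_pairSwap A σ 0 i⟩
    · refine ⟨pairSwap 0 i * Equiv.swap (eP 0) (oP 0), by simp [pairSwap_oP], fun σ => ?_⟩
      rw [← mul_assoc, pfTerm_flip A hA, pfTerm_pairSwap]
  conv_rhs => rw [← Equiv.sum_comp (Equiv.mulRight π)]
  simp only [Equiv.coe_mulRight, Equiv.Perm.mul_apply, hπ, h0]

lemma pfT_expand {m : ℕ} (A : Fin (2 * m + 2) → Fin (2 * m + 2) → K)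
    (hA : ∀ i j, A j i = - A i j) :
    pfT (m := m + 1) A = (2 * (m + 1) : ℕ) * ∑ k : Fin (2 * m + 1), (-1) ^ (k : ℕ) * A 0 k.succ *
      pfT (m := m) (fun i j => A (k.succAbove i).succ (k.succAbove j).succ) := by
  have h1 : pfT (m := m + 1) A = ∑ t : Fin (2 * (m + 1)),
      ∑ σ : Equiv.Perm (Fin (2 * (m + 1))), (if σ t = eP 0 then pfTerm (m := m + 1) A σ else 0) := by
    rw [Finset.sum_comm]
    refine Finset.sum_congr rfl fun σ _ => ?_
    rw [Finset.sum_eq_single (σ.symm (eP 0))]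
    · simp
    · intro b _ hb
      rw [if_neg]
      intro h; apply hb; rw [← h]; simp
    · simp
  rw [h1, Finset.sum_congr rfl (fun t _ => pfT_fixed (m := m) A hA t), Finset.sum_const]
  simp only [Finset.card_univ, Fintype.card_fin, nsmul_eq_mul]
  congr 1
  have h2 := sum_perm_succ_s17 (n := 2 * m + 1) (K := K)
    (fun σ => if σ 0 = 0 then pfTerm (m := m + 1) A σ else 0)
  refine Eq.trans h2 ?_
  simp only [permJ_zero]
  rw [Finset.sum_eq_single 0 (by intro b _ hb; simp [hb]) (by simp)]
  simp only [if_true]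
  rw [sum_perm_succ_s17]
  refine Finset.sum_congr rfl fun k _ => ?_
  rw [pfT, Finset.mul_sum]
  refine Finset.sum_congr rfl fun ρ _ => ?_
  have hs : ((Equiv.Perm.sign (permJ 0 (permJ k ρ)) : ℤ) : K)
    = (-1) ^ (k : ℕ) * ((Equiv.Perm.sign ρ : ℤ) : K) := by
    rw [permJ_sign, permJ_sign]; simp
  have hp : ∏ i : Fin (m + 1), A (permJ 0 (permJ k ρ) (eP (m := m + 1) i))
      (permJ 0 (permJ k ρ) (oP (m := m + 1) i)) =
      A 0 k.succ * ∏ i : Fin m, A (k.succAbove (ρ (eP i))).succ (k.succAbove (ρ (oP i))).succ := by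
    rw [Fin.prod_univ_succ]
    congr 1
    · have e0 : (eP (m := m + 1) 0 : Fin (2 * m + 2)) = 0 := rfl
      have o0 : (oP (m := m + 1) 0 : Fin (2 * m + 2)) = Fin.succ 0 := rfl
      rw [e0, o0, permJ_zero, permJ_succ, permJ_zero, Fin.succAbove_zero]
    · refine Finset.prod_congr rfl fun i _ => ?_
      have e0 : (eP (m := m + 1) i.succ : Fin (2 * m + 2)) = (eP i).succ.succ := by
        apply Fin.ext; simp [eP]; ring
      have o0 : (oP (m := m + 1) i.succ : Fin (2 * m + 2)) = (oP i).succ.succ := by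
        apply Fin.ext; simp [oP]; ring
      rw [e0, o0, permJ_succ, permJ_succ, permJ_succ, permJ_succ, Fin.succAbove_zero]
  have := congrArg₂ (· * ·) hs hp
  refine Eq.trans this ?_
  simp only [pfTerm]
  ring

/-- Recursive Pfaffian. -/
def pfR : (N : ℕ) → (Fin N → Fin N → K) → K
  | 0, _ => 1
  | 1, _ => 0
  | N + 2, A => ∑ k : Fin (N + 1), (-1) ^ (k : ℕ) * A 0 k.succ *
      pfR N (fun i j => A (k.succAbove i).succ (k.succAbove j).succ)

lemma pfR_succ (N : ℕ) (A : Fin (N + 2) → Fin (N + 2) → K) :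
    pfR (N + 2) A = ∑ k : Fin (N + 1), (-1) ^ (k : ℕ) * A 0 k.succ *
      pfR N (fun i j => A (k.succAbove i).succ (k.succAbove j).succ) := by
  rw [pfR]

lemma pfT_eq_pfR (m : ℕ) (A : Fin (2 * m) → Fin (2 * m) → K) (hA : ∀ i j, A j i = - A i j) :
    pfT A = ((2 ^ m * Nat.factorial m : ℕ) : K) * pfR (2 * m) A := by
  induction m with
  | zero => simp [pfT, pfTerm, pfR]
  | succ m ih =>
    have h1 := pfT_expand A hA
    have h2 := pfR_succ (2 * m) A
    refine h1.trans (Eq.trans ?_ (congrArg _ h2).symm)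
    rw [Finset.mul_sum, Finset.mul_sum]
    refine Finset.sum_congr rfl fun k _ => ?_
    rw [ih _ (fun i j => hA _ _)]
    push_cast [Nat.factorial_succ, pow_succ]
    ring

lemma pfaffian_eq_pfR [CharZero K] (m : ℕ) (A : Fin (2 * m) → Fin (2 * m) → K) (hA : ∀ i j, A j i = - A i j) :
    pfaffian A = pfR (2 * m) A := by
  rw [pfaffian_eq_pfT, pfT_eq_pfR m A hA, mul_div_cancel_left₀]
  exact_mod_cast (by positivity)

lemma pfR_repeat [CharZero K] (m : ℕ) (A : Fin (2 * m) → Fin (2 * m) → K) (hA : ∀ i j, A j i = - A i j)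
    (p q : Fin (2 * m)) (hpq : p ≠ q) (h : ∀ j, A p j = A q j) : pfR (2 * m) A = 0 := by
  have h' : ∀ j, A j p = A j q := fun j => by rw [hA p j, hA q j, h]
  have hs : ∀ i j, A (Equiv.swap p q i) (Equiv.swap p q j) = A i j := by
    have hl : ∀ i j, A (Equiv.swap p q i) j = A i j := by
      intro i j
      rw [Equiv.swap_apply_def]
      split_ifs with h1 h2
      · rw [h1, h j]
      · rw [h2, h j]
      · rfl
    intro i j
    rw [hl, hA (Equiv.swap p q j) i, hl, ← hA j i]
  have h0 : pfT A = - pfT A := by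
    conv_lhs => rw [pfT, ← Equiv.sum_comp (Equiv.mulLeft (Equiv.swap p q))]
    rw [pfT, ← Finset.sum_neg_distrib]
    refine Finset.sum_congr rfl fun σ _ => ?_
    simp [pfTerm, hs, Equiv.Perm.sign_swap hpq]
  have h1 : pfT A = 0 := by
    have : (2 : K) * pfT A = 0 := by linear_combination h0
    simpa using this
  rw [pfT_eq_pfR m A hA] at h1
  rcases mul_eq_zero.mp h1 with h2 | h2
  · exfalso
    have : (2 ^ m * Nat.factorial m : ℕ) ≠ 0 := by positivity
    exact this (by exact_mod_cast h2)
  · exact h2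

end Pf

section PartialFractions

open Polynomial

variable {K : Type*} [Field K]

lemma prod_erase_succAbove {n : ℕ} (k : Fin (n + 1)) (f : Fin (n + 1) → K) :
    ∏ l ∈ Finset.univ.erase k, f l = ∏ l, f (k.succAbove l) := by
  have : Finset.univ.erase k = Finset.univ.image k.succAbove := by
    ext l
    simp only [Finset.mem_erase, Finset.mem_univ, and_true, Finset.mem_image, true_and]
    exact (Fin.exists_succAbove_eq_iff).symm
  rw [this, Finset.prod_image]
  intro a _ b _ h
  exact Fin.succAbove_right_injective h

lemma prod_erase_ite {n : ℕ} (k : Fin n) (f : Fin n → K) :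
    ∏ l ∈ Finset.univ.erase k, f l = ∏ l, if l = k then 1 else f l := by
  rw [← Finset.mul_prod_erase (a := k) Finset.univ _ (Finset.mem_univ k)]
  simp only [if_true, one_mul]
  refine Finset.prod_congr rfl fun l hl => ?_
  rw [if_neg (Finset.ne_of_mem_erase hl)]

lemma pfrac {n : ℕ} (y : Fin n → K) (hy : Function.Injective y) (h0 : ∀ i, y i ≠ 0)
    (h1 : ∀ i, y i ≠ 1) (P : K[X]) (hP : P.natDegree ≤ n) :
    ∑ j, P.eval (y j) / (y j * (y j - 1) * ∏ l ∈ Finset.univ.erase j, (y j - y l))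
      = P.eval 0 / ∏ l, (- y l) - P.eval 1 / ∏ l, (1 - y l) := by
  have hinj : Function.Injective (Fin.cons 0 (Fin.cons 1 y) : Fin (n + 2) → K) := by
    rw [Fin.cons_injective_iff, Fin.cons_injective_iff]
    refine ⟨?_, ?_, hy⟩
    · rintro ⟨i, hi⟩
      induction i using Fin.cases with
      | zero => simp at hi
      | succ i => exact h0 i (by simpa using hi)
    · rintro ⟨i, hi⟩
      exact h1 i hi
  have key := Lagrange.coeff_eq_sum (s := (Finset.univ : Finset (Fin (n + 2))))
    (v := (Fin.cons 0 (Fin.cons 1 y) : Fin (n + 2) → K)) hinj.injOn (P := P) (by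
      rw [Finset.card_univ, Fintype.card_fin]
      refine lt_of_le_of_lt P.degree_le_natDegree ?_
      exact_mod_cast (by omega))
  rw [coeff_eq_zero_of_natDegree_lt (by simp; omega)] at key
  simp only [prod_erase_ite] at key ⊢
  simp only [Fin.sum_univ_succ, Fin.prod_univ_succ, Fin.cons_zero, Fin.cons_succ, if_true,
    (Fin.succ_ne_zero _).symm, Fin.succ_ne_zero, if_false, Fin.succ_inj, one_mul, sub_zero,
    zero_sub] at key
  have e : ∀ j, y j * (y j - 1) * (∏ l, if l = j then 1 else (y j - y l))
    = y j * ((y j - 1) * ∏ l, if l = j then 1 else (y j - y l)) := fun j => by ring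
  simp only [e]
  rw [neg_one_mul, div_neg] at key
  linear_combination -key

/-- Genericity assumptions. -/
structure Gen {n : ℕ} (w : K) (x : Fin n → K) : Prop where
  inj : Function.Injective x
  ne0 : ∀ i, x i ≠ 0
  ne1 : ∀ i, 1 - x i ≠ 0
  nemul : ∀ i j, i ≠ j → 1 - x i * x j ≠ 0
  neP : ∀ i j, i ≠ j → x i + x j + w * x i * x j ≠ 0
  neq : ∀ i, 1 + w * x i ≠ 0
  ner : ∀ i, 1 + (1 + w) * x i ≠ 0
  prod : ∀ s : Finset (Fin n), s.Nonempty → 1 - ∏ i ∈ s, x i ≠ 0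

lemma Gen.comp {n m : ℕ} {w : K} {x : Fin n → K} (h : Gen w x) (f : Fin m → Fin n)
    (hf : Function.Injective f) : Gen w (fun i => x (f i)) where
  inj := h.inj.comp hf
  ne0 i := h.ne0 _
  ne1 i := h.ne1 _
  nemul i j hij := h.nemul _ _ (hf.ne hij)
  neP i j hij := h.neP _ _ (hf.ne hij)
  neq i := h.neq _
  ner i := h.ner _
  prod s hs := by
    have := h.prod (s.map ⟨f, hf⟩) (by simpa using hs)
    simpa using this

def ak (w a b : K) : K := ((b - a) * (1 + (1 + w) * a * b)) / ((a + b + w * a * b) * (1 - a * b))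

lemma ak_skew (w a b : K) : ak w b a = - ak w a b := by
  unfold ak
  rw [← neg_div]
  congr 1 <;> ring

def vv {n : ℕ} (x : Fin n → K) (j : Fin n) : K :=
  (∏ l, (1 - x l * x j)) / (x j * (1 - x j) * ∏ l ∈ Finset.univ.erase j, (x j - x l))

def cc {n : ℕ} (w : K) (x : Fin n → K) (i : Fin n) : K :=
  (1 - x i) * ∏ l ∈ Finset.univ.erase i,
    (x l * (1 + w * x i + x i * x l) / (x i + x l + w * x i * x l))

lemma prod_neg' {n : ℕ} (x : Fin n → K) : ∏ l, (- x l) = (-1) ^ n * ∏ l, x l := by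
  rw [Finset.prod_neg]; simp

lemma natDegree_lin (a : K) : (1 + C a * X : K[X]).natDegree ≤ 1 := by
  compute_degree

lemma natDegree_prod_lin {n : ℕ} (s : Finset (Fin n)) (x : Fin n → K) :
    (∏ l ∈ s, (1 - C (x l) * X : K[X])).natDegree ≤ s.card := by
  refine (natDegree_prod_le _ _).trans ?_
  refine (Finset.sum_le_card_nsmul _ _ 1 fun l _ => ?_).trans (by simp)
  compute_degree

lemma sum_vv {n : ℕ} (w : K) (x : Fin n → K) (h : Gen w x) :
    (∏ l, x l) * ∑ j, vv x j = (∏ l, x l) - (-1) ^ n := by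
  have key := pfrac x h.inj h.ne0 (fun i hi => h.ne1 i (by rw [hi]; simp))
    (∏ l, (1 - C (x l) * X : K[X])) ((natDegree_prod_lin _ _).trans (by simp))
  simp only [eval_prod, eval_sub, eval_one, eval_mul, eval_C, eval_X, mul_zero, sub_zero,
    Finset.prod_const_one, mul_one] at key
  rw [div_self (Finset.prod_ne_zero_iff.mpr fun l _ => h.ne1 l), prod_neg'] at key
  have e : ∑ j, vv x j = - ∑ j, (∏ l, (1 - x l * x j)) /
      (x j * (x j - 1) * ∏ l ∈ Finset.univ.erase j, (x j - x l)) := by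
    rw [← Finset.sum_neg_distrib]
    refine Finset.sum_congr rfl fun j _ => ?_
    rw [vv, ← div_neg]
    congr 1; ring
  have hX : ∏ l, x l ≠ 0 := Finset.prod_ne_zero_iff.mpr fun l _ => h.ne0 l
  have hn : ((-1 : K) ^ n) * (-1) ^ n = 1 := by rw [← mul_pow]; simp
  have hn0 : ((-1 : K) ^ n) ≠ 0 := by simp
  rw [e, key]
  field_simp
  linear_combination hn

lemma sum_ak_vv {n : ℕ} (w : K) (x : Fin n → K) (h : Gen w x) (i : Fin n) :
    (∏ l, x l) * ∑ j, ak w (x i) (x j) * vv x j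
      = (∏ l, x l) + (-1) ^ n - (-1) ^ n * cc w x i := by
  obtain ⟨ζ, hζ⟩ : ∃ ζ, ζ = - x i / (1 + w * x i) := ⟨_, rfl⟩
  have hq := h.neq i
  have hr := h.ner i
  have h0 := h.ne0 i
  have hζ' : ζ * (1 + w * x i) = - x i := by rw [hζ, div_mul_cancel₀ _ hq]
  have hζ0 : ζ ≠ 0 := by rw [hζ]; exact div_ne_zero (neg_ne_zero.mpr h0) hq
  have hζ1 : ζ - 1 ≠ 0 := by
    intro h1
    have : ζ = 1 := by linear_combination h1
    rw [this] at hζ'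
    exact hr (by linear_combination hζ')
  have hζx : ∀ l, x l - ζ = (x i + x l + w * x i * x l) / (1 + w * x i) := by
    intro l; rw [eq_div_iff hq]; linear_combination -hζ'
  have hζx' : ∀ l, l ≠ i → x l - ζ ≠ 0 := by
    intro l hl; rw [hζx]; exact div_ne_zero (h.neP _ _ hl.symm) hq
  obtain ⟨y, hy⟩ : ∃ y, y = Function.update x i ζ := ⟨_, rfl⟩
  have yi : y i = ζ := by simp [hy]
  have yl : ∀ l, l ≠ i → y l = x l := by intro l hl; simp [hy, hl]
  have yinj : Function.Injective y := by
    intro a b hab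
    by_cases ha : a = i <;> by_cases hb : b = i
    · rw [ha, hb]
    · rw [ha, yi, yl b hb] at hab
      exact absurd (by rw [hab]; ring) (hζx' b hb)
    · rw [hb, yi, yl a ha] at hab
      exact absurd (by rw [hab]; ring) (hζx' a ha)
    · rw [yl a ha, yl b hb] at hab
      exact h.inj hab
  have y0 : ∀ l, y l ≠ 0 := by
    intro l
    by_cases hl : l = i
    · rw [hl, yi]; exact hζ0
    · rw [yl l hl]; exact h.ne0 l
  have y1 : ∀ l, y l ≠ 1 := by
    intro l
    by_cases hl : l = i
    · rw [hl, yi]; exact fun h => hζ1 (by rw [h]; ring)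
    · rw [yl l hl]; exact fun h' => h.ne1 l (by rw [h']; ring)
  have key := pfrac y yinj y0 y1
    ((1 + C ((1 + w) * x i) * X) * ∏ l ∈ Finset.univ.erase i, (1 - C (x l) * X : K[X])) (by
      refine natDegree_mul_le.trans ?_
      have h1 := natDegree_lin ((1 + w) * x i)
      have h2 := natDegree_prod_lin (Finset.univ.erase i) x
      have h3 : (Finset.univ.erase i : Finset (Fin n)).card = n - 1 := by simp
      have h4 := i.pos
      omega)
  simp only [eval_prod, eval_sub, eval_add, eval_one, eval_mul, eval_C, eval_X, mul_zero, sub_zero,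
    Finset.prod_const_one, mul_one, add_zero] at key
  have hX : ∏ l, x l = x i * ∏ l ∈ Finset.univ.erase i, x l :=
    (Finset.mul_prod_erase _ _ (Finset.mem_univ i)).symm
  have hE0 : ∏ l ∈ Finset.univ.erase i, x l ≠ 0 := Finset.prod_ne_zero_iff.mpr fun l _ => h.ne0 l
  have hE1 : ∏ l ∈ Finset.univ.erase i, (1 - x l) ≠ 0 :=
    Finset.prod_ne_zero_iff.mpr fun l _ => h.ne1 l
  have e1 : ∏ l, (- y l) = (-1) ^ n * (ζ * ∏ l ∈ Finset.univ.erase i, x l) := by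
    rw [prod_neg', ← Finset.mul_prod_erase _ _ (Finset.mem_univ i), yi]
    rw [Finset.prod_congr rfl fun l hl => yl l (Finset.ne_of_mem_erase hl)]
  have e2 : ∏ l, (1 - y l) = (1 - ζ) * ∏ l ∈ Finset.univ.erase i, (1 - x l) := by
    rw [← Finset.mul_prod_erase _ _ (Finset.mem_univ i), yi]
    rw [Finset.prod_congr rfl fun l hl => by rw [yl l (Finset.ne_of_mem_erase hl)]]
  have e3 : ∏ l ∈ Finset.univ.erase i, (y i - y l)
      = ∏ l ∈ Finset.univ.erase i, (ζ - x l) := by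
    rw [yi]
    exact Finset.prod_congr rfl fun l hl => by rw [yl l (Finset.ne_of_mem_erase hl)]
  rw [← Finset.add_sum_erase _ _ (Finset.mem_univ i), e1, e2, e3, yi] at key
  have e4 : ∀ j ∈ Finset.univ.erase i,
      ((1 + (1 + w) * x i * y j) * ∏ l ∈ Finset.univ.erase i, (1 - x l * y j)) /
        (y j * (y j - 1) * ∏ l ∈ Finset.univ.erase j, (y j - y l))
      = - (1 + w * x i) * (ak w (x i) (x j) * vv x j) := by
    intro j hj
    have hj := Finset.ne_of_mem_erase hj
    have hji : i ∈ Finset.univ.erase j := Finset.mem_erase.mpr ⟨hj.symm, Finset.mem_univ _⟩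
    rw [yl j hj, vv, ak, ← Finset.mul_prod_erase _ _ (Finset.mem_univ i),
      ← Finset.mul_prod_erase _ _ hji, ← Finset.mul_prod_erase _ (fun l => x j - x l) hji, yi,
      hζx j]
    have ey : ∏ l ∈ (Finset.univ.erase j).erase i, (x j - y l)
        = ∏ l ∈ (Finset.univ.erase j).erase i, (x j - x l) :=
      Finset.prod_congr rfl fun l hl => by rw [yl l (Finset.ne_of_mem_erase hl)]
    rw [ey]
    have n1 : ∏ l ∈ (Finset.univ.erase j).erase i, (x j - x l) ≠ 0 :=
      Finset.prod_ne_zero_iff.mpr fun l hl => sub_ne_zero.mpr fun h' =>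
        (Finset.ne_of_mem_erase (Finset.mem_of_mem_erase hl)) (h.inj h').symm
    have n2 := h.neP i j hj.symm
    have n3 := h.nemul i j hj.symm
    have n4 := h.ne0 j
    have n5 := h.ne1 j
    have n6 : x j - x i ≠ 0 := sub_ne_zero.mpr fun h' => hj (h.inj h')
    have n7 : x j - 1 ≠ 0 := fun h' => n5 (by linear_combination -h')
    generalize ∏ l ∈ (Finset.univ.erase j).erase i, (x j - x l) = Q at *
    generalize ∏ l ∈ Finset.univ.erase i, (1 - x l * x j) = R at *
    field_simp
    ring
  rw [Finset.sum_congr rfl e4, ← Finset.mul_sum] at key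
  have e5 : ∑ j, ak w (x i) (x j) * vv x j
      = ∑ j ∈ Finset.univ.erase i, ak w (x i) (x j) * vv x j := by
    rw [← Finset.add_sum_erase _ _ (Finset.mem_univ i)]
    simp [ak]
  rw [e5]
  have hcard : (Finset.univ.erase i : Finset (Fin n)).card + 1 = n := by
    have h4 := i.pos
    simp; omega
  have hn : ((-1 : K) ^ n) = - (-1) ^ (Finset.univ.erase i : Finset (Fin n)).card := by
    conv_lhs => rw [← hcard]
    rw [pow_succ]; ring
  have e6 : (∏ l ∈ Finset.univ.erase i, (1 - x l * ζ)) / ∏ l ∈ Finset.univ.erase i, (ζ - x l)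
      = - (-1) ^ n * ∏ l ∈ Finset.univ.erase i,
          ((1 + w * x i + x i * x l) / (x i + x l + w * x i * x l)) := by
    rw [hn, neg_neg, ← Finset.prod_const, ← Finset.prod_mul_distrib, ← Finset.prod_div_distrib]
    refine Finset.prod_congr rfl fun l hl => ?_
    have hl := Finset.ne_of_mem_erase hl
    have n1 := h.neP i l hl.symm
    have n2 := hζx' l hl
    have n3 : ζ - x l ≠ 0 := fun h' => n2 (by linear_combination -h')
    rw [← mul_div_assoc, div_eq_div_iff n3 n1]
    linear_combination (1 - x l ^ 2) * hζ'
  have e7 : cc w x i = (1 - x i) * ((∏ l ∈ Finset.univ.erase i, x l) *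
      ∏ l ∈ Finset.univ.erase i,
          ((1 + w * x i + x i * x l) / (x i + x l + w * x i * x l))) := by
    rw [cc, ← Finset.prod_mul_distrib]
    simp only [mul_div_assoc]
  rw [mul_div_mul_comm, e6] at key
  rw [e7, hX]
  have hs : ((-1 : K) ^ n) * (-1) ^ n = 1 := by rw [← mul_pow]; simp
  have hs0 : ((-1 : K) ^ n) ≠ 0 := by simp
  have hζ2 : 1 - ζ ≠ 0 := fun h' => hζ1 (by linear_combination -h')
  have k1 : (1 + (1 + w) * x i * ζ) / (ζ * (ζ - 1)) = (1 + w * x i) * (1 - x i) / x i := by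
    rw [div_eq_div_iff (mul_ne_zero hζ0 hζ1) h0]
    have : (1 + (1 + w) * x i * ζ) * (1 + w * x i) = (1 - x i) * (1 + (1 + w) * x i) := by
      linear_combination ((1 + w) * x i) * hζ'
    apply mul_right_cancel₀ hq
    have t : (ζ - 1) * (1 + w * x i) = - (1 + (1 + w) * x i) := by linear_combination hζ'
    calc (1 + (1 + w) * x i * ζ) * x i * (1 + w * x i)
        = ((1 + (1 + w) * x i * ζ) * (1 + w * x i)) * x i := by ring
      _ = (1 - x i) * (1 + (1 + w) * x i) * x i := by rw [this]
      _ = (1 - x i) * (ζ * (1 + w * x i)) * ((ζ - 1) * (1 + w * x i)) := by rw [hζ', t]; ring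
      _ = _ := by ring
  have k2 : (1 + (1 + w) * x i) * (∏ l ∈ Finset.univ.erase i, (1 - x l)) /
      ((1 - ζ) * ∏ l ∈ Finset.univ.erase i, (1 - x l)) = 1 + w * x i := by
    rw [mul_div_mul_right _ _ hE1, div_eq_iff hζ2]
    linear_combination hζ'
  have k3 : 1 / ((-1) ^ n * (ζ * ∏ l ∈ Finset.univ.erase i, x l))
      = - (1 + w * x i) * (-1) ^ n / (x i * ∏ l ∈ Finset.univ.erase i, x l) := by
    rw [div_eq_div_iff (mul_ne_zero hs0 (mul_ne_zero hζ0 hE0)) (mul_ne_zero h0 hE0)]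
    linear_combination (ζ * (1 + w * x i) * ∏ l ∈ Finset.univ.erase i, x l) * hs
      + (∏ l ∈ Finset.univ.erase i, x l) * hζ'
  rw [k1, k2, k3] at key
  generalize ∏ l ∈ Finset.univ.erase i, x l = E at *
  generalize ∏ l ∈ Finset.univ.erase i,
          ((1 + w * x i + x i * x l) / (x i + x l + w * x i * x l)) = R at *
  generalize ∑ j ∈ Finset.univ.erase i, ak w (x i) (x j) * vv x j = S at *
  field_simp at key
  linear_combination -key
end PartialFractions

section Main

variable {K : Type*} [Field K]

/-- Bordered skew-symmetric matrix. -/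
def bord {n : ℕ} (A : Fin n → Fin n → K) (b : Fin n → K) : Fin (n + 1) → Fin (n + 1) → K :=
  fun i j => Fin.cases (motive := fun _ => K)
    (Fin.cases (motive := fun _ => K) 0 b j)
    (fun i' => Fin.cases (motive := fun _ => K) (- b i') (A i') j) i

lemma bord_00 {n : ℕ} (A : Fin n → Fin n → K) (b : Fin n → K) : bord A b 0 0 = 0 := rfl
lemma bord_0s {n : ℕ} (A : Fin n → Fin n → K) (b : Fin n → K) (j : Fin n) :
    bord A b 0 j.succ = b j := rfl
lemma bord_s0 {n : ℕ} (A : Fin n → Fin n → K) (b : Fin n → K) (i : Fin n) :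
    bord A b i.succ 0 = - b i := rfl
lemma bord_ss {n : ℕ} (A : Fin n → Fin n → K) (b : Fin n → K) (i j : Fin n) :
    bord A b i.succ j.succ = A i j := rfl

lemma bord_skew {n : ℕ} (A : Fin n → Fin n → K) (b : Fin n → K) (hA : ∀ i j, A j i = - A i j) :
    ∀ i j, bord A b j i = - bord A b i j := by
  intro i j
  induction i using Fin.cases with
  | zero => induction j using Fin.cases with
    | zero => simp [bord_00]
    | succ j => simp [bord_0s, bord_s0]
  | succ i => induction j using Fin.cases with
    | zero => simp [bord_0s, bord_s0]
    | succ j => rw [bord_ss, bord_ss, hA]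

lemma pfR_bord (n : ℕ) (A : Fin (n + 1) → Fin (n + 1) → K) (b : Fin (n + 1) → K) :
    pfR (n + 2) (bord A b) = ∑ k : Fin (n + 1), (-1) ^ (k : ℕ) * b k *
      pfR n (fun i j => A (k.succAbove i) (k.succAbove j)) := by
  rw [pfR_succ]
  rfl

lemma bord_succAbove {n : ℕ} (A : Fin (n + 1) → Fin (n + 1) → K) (b : Fin (n + 1) → K)
    (k : Fin (n + 1)) :
    (fun i j => bord A b (k.succ.succAbove i) (k.succ.succAbove j))
      = bord (fun i j => A (k.succAbove i) (k.succAbove j)) (fun i => b (k.succAbove i)) := by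
  funext i j
  induction i using Fin.cases with
  | zero => induction j using Fin.cases with
    | zero => simp [bord_00]
    | succ j => simp [bord_0s]
  | succ i => induction j using Fin.cases with
    | zero => simp [bord_s0]
    | succ j => simp [bord_ss]

lemma pfR_bord2 (n : ℕ) (A : Fin (n + 1) → Fin (n + 1) → K) (b r : Fin (n + 1) → K) (d : K) :
    pfR (n + 3) (bord (bord A b) (Fin.cons d r)) = d * pfR (n + 1) A -
      ∑ k : Fin (n + 1), (-1) ^ (k : ℕ) * r k *
        pfR (n + 1) (bord (fun i j => A (k.succAbove i) (k.succAbove j))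
          (fun i => b (k.succAbove i))) := by
  rw [pfR_bord, Fin.sum_univ_succ]
  simp only [bord_succAbove, Fin.cons_zero, Fin.cons_succ, Fin.succAbove_zero, bord_ss,
    Fin.val_zero, pow_zero, one_mul, Fin.val_succ, pow_succ]
  rw [sub_eq_add_neg, ← Finset.sum_neg_distrib]
  congr 1
  refine Finset.sum_congr rfl fun k _ => ?_
  ring

lemma odd_id [CharZero K] (m : ℕ) (A : Fin (2 * m + 1) → Fin (2 * m + 1) → K)
    (hA : ∀ i j, A j i = - A i j) (j : Fin (2 * m + 1)) :
    ∑ k : Fin (2 * m + 1), (-1) ^ (k : ℕ) * A j k *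
      pfR (2 * m) (fun i j => A (k.succAbove i) (k.succAbove j)) = 0 := by
  rw [← pfR_bord]
  have hd : ∀ i, A i i = 0 := fun i => by
    have := hA i i
    have : (2 : K) * A i i = 0 := by linear_combination this
    simpa using this
  refine pfR_repeat (m + 1) (bord A (A j)) (bord_skew _ _ hA) (0 : Fin (2 * m + 2)) j.succ
    (Fin.succ_ne_zero j).symm ?_
  intro l
  change Fin (2 * m + 1 + 1) at l
  induction l using Fin.cases with
  | zero => rw [bord_00, bord_s0, hd, neg_zero]
  | succ l => rw [bord_0s, bord_ss]

lemma even_id0 [CharZero K] (m : ℕ) (A : Fin (2 * m + 2) → Fin (2 * m + 2) → K)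
    (hA : ∀ i j, A j i = - A i j) :
    ∑ k : Fin (2 * m + 2), (-1) ^ (k : ℕ) *
      pfR (2 * m + 2) (bord (fun i j => A (k.succAbove i) (k.succAbove j)) (fun _ => 1)) = 0 := by
  have h := pfR_bord2 (2 * m + 1) A (fun _ => 1) (fun _ => 1) 0
  have h0 : pfR (2 * m + 1 + 3) (bord (bord A (fun _ => 1)) (Fin.cons 0 (fun _ => 1))) = 0 := by
    refine pfR_repeat (m + 2) (bord (bord A (fun _ => 1)) (Fin.cons 0 (fun _ => 1)))
      (bord_skew _ _ (bord_skew _ _ hA)) (0 : Fin (2 * m + 4)) (Fin.succ 0)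
      (Fin.succ_ne_zero _).symm ?_
    intro l
    change Fin (2 * m + 3 + 1) at l
    induction l using Fin.cases with
    | zero => rw [bord_00, bord_s0, Fin.cons_zero, neg_zero]
    | succ l =>
      rw [bord_0s, bord_ss]
      induction l using Fin.cases with
      | zero => rw [bord_00, Fin.cons_zero]
      | succ l => rw [bord_0s, Fin.cons_succ]
  rw [h0] at h
  simp only [mul_one] at h
  linear_combination h

lemma even_id1 [CharZero K] (m : ℕ) (A : Fin (2 * m + 2) → Fin (2 * m + 2) → K)
    (hA : ∀ i j, A j i = - A i j) (j : Fin (2 * m + 2)) :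
    ∑ k : Fin (2 * m + 2), (-1) ^ (k : ℕ) * A j k *
      pfR (2 * m + 2) (bord (fun i j => A (k.succAbove i) (k.succAbove j)) (fun _ => 1))
      = - pfR (2 * m + 2) A := by
  have h := pfR_bord2 (2 * m + 1) A (fun _ => 1) (A j) (-1)
  have hd : ∀ i, A i i = 0 := fun i => by
    have := hA i i
    have : (2 : K) * A i i = 0 := by linear_combination this
    simpa using this
  have h0 : pfR (2 * m + 1 + 3) (bord (bord A (fun _ => 1)) (Fin.cons (-1) (A j))) = 0 := by
    refine pfR_repeat (m + 2) (bord (bord A (fun _ => 1)) (Fin.cons (-1) (A j)))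
      (bord_skew _ _ (bord_skew _ _ hA)) (0 : Fin (2 * m + 4)) (Fin.succ (Fin.succ j))
      (Fin.succ_ne_zero _).symm ?_
    intro l
    change Fin (2 * m + 3 + 1) at l
    induction l using Fin.cases with
    | zero => rw [bord_00, bord_s0, Fin.cons_succ, hd, neg_zero]
    | succ l =>
      rw [bord_0s, bord_ss]
      induction l using Fin.cases with
      | zero => rw [bord_s0, Fin.cons_zero]
      | succ l => rw [bord_ss, Fin.cons_succ]
  rw [h0] at h
  linear_combination h

def PF (n : ℕ) (w : K) (x : Fin n → K) : K :=
  if Even n then pfR n (fun i j => ak w (x i) (x j))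
  else pfR (n + 1) (bord (fun i j => ak w (x i) (x j)) (fun _ => 1))

lemma PF_rec [CharZero K] (n : ℕ) (w : K) (x : Fin (n + 1) → K) (h : Gen w x) :
    ∑ k : Fin (n + 1), (-1) ^ (k : ℕ) * cc w x k * PF n w (fun i => x (k.succAbove i))
      = (1 - ∏ l, x l) * PF (n + 1) w x := by
  have hsk : ∀ i j, ak w (x j) (x i) = - ak w (x i) (x j) := fun i j => ak_skew _ _ _
  rcases Nat.even_or_odd' n with ⟨m, rfl | rfl⟩
  · have e1 : Even (2 * m) := by simp
    have e2 : ¬ Even (2 * m + 1) := by simp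
    simp only [PF, if_pos e1, if_neg e2]
    rw [pfR_bord]
    have hc : ∀ k, cc w x k = (1 - ∏ l, x l)
        - (∏ l, x l) * ∑ j, vv x j * ak w (x j) (x k) := by
      intro k
      have := sum_ak_vv w x h k
      have hp : ((-1 : K)) ^ (2 * m + 1) = -1 := by simp [pow_succ, pow_mul]
      rw [hp] at this
      have e : ∑ j, vv x j * ak w (x j) (x k) = - ∑ j, ak w (x k) (x j) * vv x j := by
        rw [← Finset.sum_neg_distrib]
        refine Finset.sum_congr rfl fun j _ => ?_
        rw [hsk k j]; ring
      rw [e]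
      linear_combination -this
    have hz := fun j => odd_id m (fun i j => ak w (x i) (x j)) hsk j
    have hz' : ∑ j, vv x j * ∑ k : Fin (2 * m + 1), (-1) ^ (k : ℕ) * ak w (x j) (x k) *
      pfR (2 * m) (fun i j => ak w (x (k.succAbove i)) (x (k.succAbove j))) = 0 :=
      Finset.sum_eq_zero fun j _ => by rw [hz j, mul_zero]
    simp only [Finset.mul_sum] at hz'
    rw [Finset.sum_comm] at hz'
    rw [← sub_eq_zero, Finset.mul_sum, ← Finset.sum_sub_distrib]
    rw [← mul_zero (- ∏ l, x l), ← hz', Finset.mul_sum]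
    refine Finset.sum_congr rfl fun k _ => ?_
    have e3 : ∑ j, vv x j * ((-1) ^ (k : ℕ) * ak w (x j) (x k) *
        pfR (2 * m) (fun i j => ak w (x (k.succAbove i)) (x (k.succAbove j))))
      = (∑ j, vv x j * ak w (x j) (x k)) * ((-1) ^ (k : ℕ) *
        pfR (2 * m) (fun i j => ak w (x (k.succAbove i)) (x (k.succAbove j)))) := by
      rw [Finset.sum_mul]
      exact Finset.sum_congr rfl fun j _ => by ring
    rw [e3, hc k]
    ring
  · have e1 : Even (2 * m + 1 + 1) := by simp [Nat.even_add_one]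
    have e2 : ¬ Even (2 * m + 1) := by simp
    simp only [PF, if_pos e1, if_neg e2]
    have hc : ∀ k, cc w x k = (1 + ∏ l, x l)
        + (∏ l, x l) * ∑ j, vv x j * ak w (x j) (x k) := by
      intro k
      have := sum_ak_vv w x h k
      have hp : ((-1 : K)) ^ (2 * m + 1 + 1) = 1 := by simp [pow_succ, pow_mul]
      rw [hp] at this
      have e : ∑ j, vv x j * ak w (x j) (x k) = - ∑ j, ak w (x k) (x j) * vv x j := by
        rw [← Finset.sum_neg_distrib]
        refine Finset.sum_congr rfl fun j _ => ?_
        rw [hsk k j]; ring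
      rw [e]
      linear_combination this
    have hz0 := even_id0 m (fun i j => ak w (x i) (x j)) hsk
    have hz := fun j => even_id1 m (fun i j => ak w (x i) (x j)) hsk j
    have hv := sum_vv w x h
    have hp : ((-1 : K)) ^ (2 * m + 1 + 1) = 1 := by simp [pow_succ, pow_mul]
    rw [hp] at hv
    have hz' : ∑ j, vv x j * ∑ k : Fin (2 * m + 2), (-1) ^ (k : ℕ) * ak w (x j) (x k) *
      pfR (2 * m + 2) (bord (fun i j => ak w (x (k.succAbove i)) (x (k.succAbove j))) (fun _ => 1))
      = ∑ j, vv x j * - pfR (2 * m + 2) (fun i j => ak w (x i) (x j)) :=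
      Finset.sum_congr rfl fun j _ => by rw [hz j]
    rw [← Finset.sum_mul] at hz'
    simp only [Finset.mul_sum] at hz'
    rw [Finset.sum_comm] at hz'
    have hfin : ∑ k : Fin (2 * m + 2), (-1) ^ (k : ℕ) * cc w x k *
      pfR (2 * m + 2) (bord (fun i j => ak w (x (k.succAbove i)) (x (k.succAbove j))) (fun _ => 1))
      = (1 + ∏ l, x l) * (∑ k : Fin (2 * m + 2), (-1) ^ (k : ℕ) *
      pfR (2 * m + 2) (bord (fun i j => ak w (x (k.succAbove i)) (x (k.succAbove j))) (fun _ => 1)))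
      + (∏ l, x l) * ∑ k : Fin (2 * m + 2), ∑ j, vv x j * ((-1) ^ (k : ℕ) * ak w (x j) (x k) *
      pfR (2 * m + 2)
        (bord (fun i j => ak w (x (k.succAbove i)) (x (k.succAbove j))) (fun _ => 1))) := by
      rw [Finset.mul_sum, Finset.mul_sum, ← Finset.sum_add_distrib]
      refine Finset.sum_congr rfl fun k _ => ?_
      have e3 : ∑ j, vv x j * ((-1) ^ (k : ℕ) * ak w (x j) (x k) *
          pfR (2 * m + 2)
            (bord (fun i j => ak w (x (k.succAbove i)) (x (k.succAbove j))) (fun _ => 1)))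
        = (∑ j, vv x j * ak w (x j) (x k)) * ((-1) ^ (k : ℕ) *
          pfR (2 * m + 2)
            (bord (fun i j => ak w (x (k.succAbove i)) (x (k.succAbove j))) (fun _ => 1))) := by
        rw [Finset.sum_mul]
        exact Finset.sum_congr rfl fun j _ => by ring
      rw [e3, hc k]
      ring
    refine hfin.trans ?_
    rw [hz', hz0]
    linear_combination (- pfR (2 * m + 2) (fun i j => ak w (x i) (x j))) * hv

def FF (n : ℕ) (w : K) (x : Fin n → K) : K :=
  ∑ σ : Equiv.Perm (Fin n), ((Equiv.Perm.sign σ : ℤ) : K) *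
        ((∏ i : Fin n, ∏ j ∈ Finset.univ.filter (fun j => i < j),
            (x (σ i) * x (σ j) + 1 + w * x (σ i))) *
          ∏ i : Fin n, (x (σ i) ^ (i : ℕ) *
            (1 - ∏ j ∈ Finset.univ.filter (fun j => i ≤ j), x (σ j))⁻¹))

lemma FF_rec (n : ℕ) (w : K) (x : Fin (n + 1) → K) :
    FF (n + 1) w x = ∑ k : Fin (n + 1), (-1) ^ (k : ℕ) *
      ((∏ l, (x (k.succAbove l) * (1 + w * x k + x k * x (k.succAbove l)))) *
        (1 - ∏ l, x l)⁻¹) * FF n w (fun i => x (k.succAbove i)) := by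
  rw [FF, sum_perm_succ_s17]
  refine Finset.sum_congr rfl fun k _ => ?_
  rw [FF, Finset.mul_sum]
  refine Finset.sum_congr rfl fun τ _ => ?_
  have hall : ∏ j, x (permJ k τ j) = ∏ l, x l := Equiv.prod_comp (permJ k τ) x
  rw [permJ_sign]
  simp only [Finset.prod_filter]
  rw [Fin.prod_univ_succ]
  rw [Fin.prod_univ_succ (fun i => x (permJ k τ i) ^ (i : ℕ) * _)]
  simp only [Fin.zero_le, if_true, hall]
  simp only [Fin.prod_univ_succ (n := n), permJ_zero, permJ_succ, Fin.succ_pos, if_true,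
    lt_irrefl, if_false, one_mul, Fin.succ_lt_succ_iff, Fin.succ_le_succ_iff, Fin.not_lt_zero,
    Fin.val_zero, pow_zero, Fin.val_succ, pow_succ, Fin.le_zero_iff, Fin.succ_ne_zero]
  have r1 : ∏ l, (x k * x (k.succAbove (τ l)) + 1 + w * x k)
      = ∏ l, (1 + w * x k + x k * x (k.succAbove l)) := by
    rw [← Equiv.prod_comp τ (fun l => 1 + w * x k + x k * x (k.succAbove l))]
    exact Finset.prod_congr rfl fun l _ => by ring
  have r2 : ∏ l, x (k.succAbove (τ l)) = ∏ l, x (k.succAbove l) :=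
    Equiv.prod_comp τ (fun l => x (k.succAbove l))
  simp only [Finset.prod_mul_distrib, r1, r2]
  ring

def DD (n : ℕ) (w : K) (x : Fin n → K) : K :=
  ∏ i : Fin n, ∏ j ∈ Finset.univ.filter (fun j => i < j), (x i + x j + w * x i * x j)

lemma DD_rec (n : ℕ) (w : K) (x : Fin (n + 1) → K) (k : Fin (n + 1)) :
    DD (n + 1) w x = (∏ l, (x k + x (k.succAbove l) + w * x k * x (k.succAbove l))) *
      DD n w (fun i => x (k.succAbove i)) := by
  simp only [DD, Finset.prod_filter]
  rw [Fin.prod_univ_succAbove _ k]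
  simp only [Fin.prod_univ_succAbove (n := n) _ k, lt_irrefl, if_false, one_mul,
    Finset.prod_mul_distrib, Fin.succAbove_lt_succAbove_iff]
  rw [← mul_assoc]
  congr 1
  rw [← Finset.prod_mul_distrib]
  refine Finset.prod_congr rfl fun l _ => ?_
  rcases lt_or_gt_of_ne (Fin.succAbove_ne k l) with h | h
  · rw [if_neg (not_lt_of_gt h), if_pos h]; ring
  · rw [if_pos h, if_neg (not_lt_of_gt h)]; ring

lemma main_id [CharZero K] (n : ℕ) (w : K) (x : Fin n → K) (h : Gen w x) :
    FF n w x = (∏ i, (1 - x i)⁻¹) * DD n w x * PF n w x := by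
  induction n with
  | zero => simp [FF, DD, PF, pfR]
  | succ n ih =>
    have hX : 1 - ∏ l, x l ≠ 0 := h.prod Finset.univ Finset.univ_nonempty
    have hPF : PF (n + 1) w x = (1 - ∏ l, x l)⁻¹ * ∑ k : Fin (n + 1),
        (-1) ^ (k : ℕ) * cc w x k * PF n w (fun i => x (k.succAbove i)) := by
      rw [PF_rec n w x h, inv_mul_cancel_left₀ hX]
    rw [FF_rec, hPF, Finset.mul_sum, Finset.mul_sum]
    refine Finset.sum_congr rfl fun k _ => ?_
    rw [ih _ (h.comp _ Fin.succAbove_right_injective), DD_rec n w x k, cc,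
      prod_erase_succAbove, Fin.prod_univ_succAbove (fun i => (1 - x i)⁻¹) k,
      Finset.prod_div_distrib]
    have n1 : ∏ l, (x k + x (k.succAbove l) + w * x k * x (k.succAbove l)) ≠ 0 :=
      Finset.prod_ne_zero_iff.mpr fun l _ => h.neP _ _ (Fin.succAbove_ne k l).symm
    have n2 := h.ne1 k
    generalize ∏ l, (x k + x (k.succAbove l) + w * x k * x (k.succAbove l)) = Q at *
    generalize ∏ l, (x (k.succAbove l) * (1 + w * x k + x k * x (k.succAbove l))) = R at *
    generalize ∏ l, (1 - x (k.succAbove l))⁻¹ = T at *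
    generalize (1 - ∏ l, x l)⁻¹ = U at *
    field_simp

end Main

lemma KK_ne_zero (p : MvPolynomial ℕ ℚ) (φ : ℕ → ℚ) (h : MvPolynomial.eval φ p ≠ 0) :
    algebraMap (MvPolynomial ℕ ℚ) KK p ≠ 0 := by
  intro h0
  have := (IsFractionRing.injective (MvPolynomial ℕ ℚ) KK) (h0.trans (map_zero _).symm)
  rw [this] at h
  simp at h

lemma gen_KK (n : ℕ) : Gen ww (fun i : Fin n => xx ((i : ℕ) + 1)) where
  inj := by
    intro i j h
    have := (IsFractionRing.injective (MvPolynomial ℕ ℚ) KK) h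
    have := MvPolynomial.X_injective this
    exact Fin.ext (by omega)
  ne0 i := KK_ne_zero (MvPolynomial.X ((i : ℕ) + 1)) (fun _ => 2) (by simp)
  ne1 i := by
    have := KK_ne_zero (1 - MvPolynomial.X ((i : ℕ) + 1)) (fun _ => 2) (by simp; norm_num)
    simpa [xx] using this
  nemul i j _ := by
    have := KK_ne_zero (1 - MvPolynomial.X ((i : ℕ) + 1) * MvPolynomial.X ((j : ℕ) + 1)) (fun _ => 2)
      (by simp; norm_num)
    simpa [xx] using this
  neP i j _ := by
    have := KK_ne_zero (MvPolynomial.X ((i : ℕ) + 1) + MvPolynomial.X ((j : ℕ) + 1)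
      + MvPolynomial.X 0 * MvPolynomial.X ((i : ℕ) + 1) * MvPolynomial.X ((j : ℕ) + 1)) (fun _ => 2)
      (by simp; norm_num)
    simpa [xx, ww] using this
  neq i := by
    have := KK_ne_zero (1 + MvPolynomial.X 0 * MvPolynomial.X ((i : ℕ) + 1)) (fun _ => 2)
      (by simp; norm_num)
    simpa [xx, ww] using this
  ner i := by
    have := KK_ne_zero (1 + (1 + MvPolynomial.X 0) * MvPolynomial.X ((i : ℕ) + 1)) (fun _ => 2)
      (by simp; norm_num)
    simpa [xx, ww] using this
  prod s hs := by
    have := KK_ne_zero (1 - ∏ i ∈ s, MvPolynomial.X ((i : ℕ) + 1)) (fun _ => 2) (by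
      simp only [map_sub, map_one, map_prod, MvPolynomial.eval_X, Finset.prod_const]
      have h2 : (1 : ℚ) < 2 ^ s.card := one_lt_pow₀ (by norm_num) (Finset.card_ne_zero.mpr hs)
      intro h
      linarith)
    simpa [xx] using this

lemma prod_Icc_fin (n : ℕ) (f : ℕ → KK) :
    ∏ i ∈ Finset.Icc 1 n, f i = ∏ i : Fin n, f ((i : ℕ) + 1) := by
  rw [Fin.prod_univ_eq_prod_range (fun i => f (i + 1)) n, Finset.range_eq_Ico,
    Finset.prod_Ico_add' f 0 n 1]
  rfl

lemma prod_Ioc_fin (n : ℕ) (i : Fin n) (f : ℕ → KK) :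
    ∏ j ∈ Finset.Ioc ((i : ℕ) + 1) n, f j
      = ∏ j ∈ (Finset.univ : Finset (Fin n)).filter (fun j => i < j), f ((j : ℕ) + 1) := by
  symm
  refine Finset.prod_bij (fun j _ => (j : ℕ) + 1) ?_ ?_ ?_ ?_
  · intro j hj
    have hj := (Finset.mem_filter.mp hj).2
    have : (i : ℕ) < j := hj
    simp only [Finset.mem_Ioc]
    omega
  · intro a _ b _ hab
    exact Fin.ext (by omega)
  · intro b hb
    simp only [Finset.mem_Ioc] at hb
    refine ⟨⟨b - 1, by omega⟩, ?_, ?_⟩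
    · simp only [Finset.mem_filter, Finset.mem_univ, true_and, Fin.lt_def]
      omega
    · simp only
      omega
  · intros; rfl

lemma pf_cast {K : Type*} [Field K] [CharZero K] (M N : ℕ) (h : 2 * M = N)
    (A : Fin (2 * M) → Fin (2 * M) → K) (B : Fin N → Fin N → K) (hB : ∀ i j, B j i = - B i j)
    (hAB : ∀ i j, A i j = B (Fin.cast h i) (Fin.cast h j)) : pfaffian A = pfR N B := by
  subst h
  have : A = B := by
    funext i j
    exact hAB i j
  rw [this]
  exact pfaffian_eq_pfR M B hB

lemma ak_self {K : Type*} [Field K] (w a : K) : ak w a a = 0 := by simp [ak]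

lemma pf_KK (n : ℕ) : pfaffian (pfArray n (fun p q =>
          if p = 0 then 1
          else ((xx q - xx p) * (1 + (1 + ww) * xx p * xx q)) /
            ((xx p + xx q + ww * xx p * xx q) * (1 - xx p * xx q))))
    = PF n ww (fun i : Fin n => xx ((i : ℕ) + 1)) := by
  have hsk : ∀ i j : Fin n, ak ww (xx ((j : ℕ) + 1)) (xx ((i : ℕ) + 1))
      = - ak ww (xx ((i : ℕ) + 1)) (xx ((j : ℕ) + 1)) := fun i j => ak_skew _ _ _
  have hak : ∀ p q : ℕ, ((xx q - xx p) * (1 + (1 + ww) * xx p * xx q)) /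
            ((xx p + xx q + ww * xx p * xx q) * (1 - xx p * xx q)) = ak ww (xx p) (xx q) :=
    fun p q => rfl
  simp only [hak]
  unfold PF
  by_cases he : Even n
  · rw [if_pos he]
    have hM : 2 * ((n + 1) / 2) = n := by
      obtain ⟨c, rfl⟩ := he
      omega
    refine pf_cast _ n hM _ _ hsk ?_
    intro i j
    simp only [pfArray, lab, if_pos he, Nat.succ_ne_zero, if_false, Fin.val_cast]
    split_ifs with h1 h2
    · rfl
    · rw [← ak_skew]
    · have : (i : ℕ) = j := by omega
      rw [this, ak_self]
  · rw [if_neg he]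
    have hM : 2 * ((n + 1) / 2) = n + 1 := by
      obtain ⟨c, rfl⟩ := Nat.not_even_iff_odd.mp he
      omega
    refine pf_cast _ (n + 1) hM _ _ (bord_skew _ _ hsk) ?_
    intro i j
    simp only [pfArray, lab, if_neg he]
    have hi : (i : ℕ) = (Fin.cast hM i : ℕ) := rfl
    have hj : (j : ℕ) = (Fin.cast hM j : ℕ) := rfl
    rw [hi, hj]
    generalize Fin.cast hM i = a
    generalize Fin.cast hM j = b
    induction a using Fin.cases with
    | zero => induction b using Fin.cases with
      | zero => simp [bord_00]
      | succ b => simp [bord_0s]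
    | succ a => induction b using Fin.cases with
      | zero => simp [bord_s0]
      | succ b =>
        rw [bord_ss]
        simp only [Fin.val_succ, Nat.succ_ne_zero, if_false]
        split_ifs with h1 h2
        · rfl
        · rw [← ak_skew]
        · have : (a : ℕ) = b := by omega
          rw [this, ak_self]

/-- Theorem 1.1, the Littlewood-type identity for modified Robbins polynomials:
`∑_{0 ≤ k_1 < … < k_n} R*_{(k_1,…,k_n)}(x_1,…,x_n;1,1,w)
  = ∏_i 1/(1-x_i) ∏_{i<j} (x_i + x_j + w x_i x_j)/(x_j - x_i) · pf(a_{ij})`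
with `a_{0j} = 1` and
`a_{ij} = ((x_j-x_i)(1+(1+w)x_i x_j))/((x_i+x_j+w x_i x_j)(1-x_i x_j))` for `i ≥ 1`,
in `ℚ(x_1,…,x_n,w)`.  The left-hand side is expressed, via the geometric series
evaluation `∑_{0≤k_1<…<k_n} ∏ x_i^{k_i} = ∏_i x_i^{i-1}(1-∏_{j≥i}x_j)^{-1}`, as
`asym[∏_{i<j}(x_i x_j+1+w x_i) ∏_i x_i^{i-1}(1-∏_{j=i}^n x_j)^{-1}] / ∏_{i<j}(x_j-x_i)`. -/
theorem stmt17 (n : ℕ) (hn : 0 < n) :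
    (∑ σ : Equiv.Perm (Fin n), ((Equiv.Perm.sign σ : ℤ) : KK) *
        ((∏ i : Fin n, ∏ j ∈ Finset.univ.filter (fun j => i < j),
            (xx ((σ i : ℕ) + 1) * xx ((σ j : ℕ) + 1) + 1 + ww * xx ((σ i : ℕ) + 1))) *
          ∏ i : Fin n, (xx ((σ i : ℕ) + 1) ^ (i : ℕ) *
            (1 - ∏ j ∈ Finset.univ.filter (fun j => i ≤ j), xx ((σ j : ℕ) + 1))⁻¹))) /
      (∏ i : Fin n, ∏ j ∈ Finset.univ.filter (fun j => i < j),
        (xx ((j : ℕ) + 1) - xx ((i : ℕ) + 1)))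
    = (∏ i ∈ Finset.Icc 1 n, (1 - xx i)⁻¹) *
        (∏ i ∈ Finset.Icc 1 n, ∏ j ∈ Finset.Ioc i n,
          (xx i + xx j + ww * xx i * xx j) / (xx j - xx i)) *
        pfaffian (pfArray n (fun p q =>
          if p = 0 then 1
          else ((xx q - xx p) * (1 + (1 + ww) * xx p * xx q)) /
            ((xx p + xx q + ww * xx p * xx q) * (1 - xx p * xx q)))) := by
  have hgen := gen_KK n
  have hFF := main_id n ww (fun i : Fin n => xx ((i : ℕ) + 1)) hgen
  unfold FF at hFF
  rw [hFF, pf_KK n]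
  simp only [prod_Icc_fin, prod_Ioc_fin, Finset.prod_div_distrib]
  rw [DD]
  ring

end
end
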